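/- Let M = (m_{s,t})_{s,t∈S} be a Coxeter matrix over a finite set S whose Coxeter group W_S is finite and whose Coxeter graph Γ_S is connected, let A_S be the associated Artin-Tits group, and let X be a nonempty proper subset of S such that the induced Coxeter graph Γ_X is disconnected. Then the standard parabolic subgroup A_X is NOT conjugacy stable in A_S, except in the following cases, in which A_X is conjugacy stable: (a) W_S is of type B_n (n ≥ 3) and X = {s_1} ∪ Z where Z ⊆ {s_3,…,s_n} is nonempty and Γ_Z is connected; (b) W_S is of type F_4. -/

import Mathlib

namespace ArtinTits

variable {B : Type*}

/-- The alternating product `a b a b ⋯` with `m` factors, starting with `a`. -/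
def altProd {G : Type*} [Monoid G] (a b : G) : ℕ → G
  | 0 => 1
  | n + 1 => a * altProd b a n

/-- The braid relations defining the Artin–Tits group of a Coxeter matrix:
`Π(σ_s, σ_t; m_{s,t}) = Π(σ_t, σ_s; m_{s,t})` whenever `m_{s,t} ≠ ∞` (here `∞` is coded by `0`). -/
def artinRelationsSet (M : CoxeterMatrix B) : Set (FreeGroup B) :=
  {r | ∃ s t : B, M s t ≠ 0 ∧
    r = altProd (FreeGroup.of s) (FreeGroup.of t) (M s t) *
        (altProd (FreeGroup.of t) (FreeGroup.of s) (M s t))⁻¹}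

/-- The Artin–Tits group of a Coxeter matrix. -/
abbrev ArtinGroup (M : CoxeterMatrix B) : Type _ := PresentedGroup (artinRelationsSet M)

/-- The standard generator `σ_s` of the Artin–Tits group. -/
def σ (M : CoxeterMatrix B) (s : B) : ArtinGroup M := PresentedGroup.of s

/-- The standard parabolic subgroup `A_X` of the Artin–Tits group. -/
def AP (M : CoxeterMatrix B) (X : Set B) : Subgroup (ArtinGroup M) :=
  Subgroup.closure (σ M '' X)

/-- The standard parabolic subgroup `W_X` of the Coxeter group. -/
def WP (M : CoxeterMatrix B) (X : Set B) : Subgroup M.Group :=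
  Subgroup.closure (M.simple '' X)

/-- A subgroup `H ≤ G` is conjugacy stable if any two elements of `H` which are conjugate
in `G` are already conjugate by an element of `H`. -/
def IsConjugacyStable {G : Type*} [Group G] (H : Subgroup G) : Prop :=
  ∀ a b : G, a ∈ H → b ∈ H → (∃ g : G, g⁻¹ * a * g = b) → ∃ h ∈ H, h⁻¹ * a * h = b

/-- Property `⋆_W` for the pair `(W_X, W_S)`. -/
def StarW (M : CoxeterMatrix B) (X : Set B) : Prop :=
  ∀ Y₁ Y₂ : Set B, Y₁ ⊆ X → Y₂ ⊆ X → ∀ w : M.Group,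
    (fun x => w⁻¹ * x * w) '' (M.simple '' Y₁) = M.simple '' Y₂ →
    ∃ v ∈ WP M X, ∀ y ∈ Y₁, v⁻¹ * M.simple y * v = w⁻¹ * M.simple y * w

/-- Property `⋆_A` for the pair `(A_X, A_S)`. -/
def StarA (M : CoxeterMatrix B) (X : Set B) : Prop :=
  ∀ Y₁ Y₂ : Set B, Y₁ ⊆ X → Y₂ ⊆ X → ∀ g : ArtinGroup M,
    (fun x => g⁻¹ * x * g) '' (σ M '' Y₁) = σ M '' Y₂ →
    ∃ h ∈ AP M X, ∀ y ∈ Y₁, h⁻¹ * σ M y * h = g⁻¹ * σ M y * g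

/-- Adjacency in the Coxeter graph: `s` and `t` are joined by an edge iff `m_{s,t} ≥ 3`
(where the value `0` codes `∞`, which also gives an edge). -/
def Adj (M : CoxeterMatrix B) (s t : B) : Prop := s ≠ t ∧ M s t ≠ 2

/-- `s` and `t` are connected by a path of the Coxeter graph staying inside `X`. -/
def ReachIn (M : CoxeterMatrix B) (X : Set B) (s t : B) : Prop :=
  Relation.ReflTransGen (fun a b => a ∈ X ∧ b ∈ X ∧ Adj M a b) s t

/-- The Coxeter graph induced on `X` is connected. -/
def ConnectedIn (M : CoxeterMatrix B) (X : Set B) : Prop :=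
  ∀ s ∈ X, ∀ t ∈ X, ReachIn M X s t

/-- The Coxeter matrix `M` restricted to `X` is of the type of the Coxeter matrix `M'`,
i.e. there is a bijection transporting one to the other. -/
def IsOfType {B' : Type*} (M : CoxeterMatrix B) (X : Set B) (M' : CoxeterMatrix B') : Prop :=
  ∃ e : X ≃ B', ∀ a b : X, M a.val b.val = M' (e a) (e b)

/-- The Coxeter matrix of type `Bₙ` with the paper's labelling: vertices `0, …, n-1`
(representing `s_1, …, s_n`), `m_{s_1, s_2} = 4` and `m_{s_i, s_{i+1}} = 3` for `i ≥ 2`. -/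
def Bmat (n : ℕ) : CoxeterMatrix (Fin n) where
  M := Matrix.of fun i j : Fin n ↦
    if i = j then 1
      else (if (i.val = 0 ∧ j.val = 1) ∨ (j.val = 0 ∧ i.val = 1) then 4
        else (if (j : ℕ) + 1 = i ∨ (i : ℕ) + 1 = j then 3 else 2))
  isSymm := by unfold Matrix.IsSymm; aesop
  diagonal := by simp
  off_diagonal := by aesop

/-- The Coxeter matrix of type `Dₙ` with the paper's labelling: vertices `0, …, n-1`
(representing `s_1, …, s_n`), with edges `{s_1, s_3}`, `{s_2, s_3}` and `{s_i, s_{i+1}}`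
for `i ≥ 3`, all labelled `3`. -/
def Dmat (n : ℕ) : CoxeterMatrix (Fin n) where
  M := Matrix.of fun i j : Fin n ↦
    if i = j then 1
      else (if (i.val = 0 ∧ j.val = 2) ∨ (j.val = 0 ∧ i.val = 2) then 3
        else (if i.val = 0 ∨ j.val = 0 then 2
          else (if (j : ℕ) + 1 = i ∨ (i : ℕ) + 1 = j then 3 else 2)))
  isSymm := by unfold Matrix.IsSymm; aesop
  diagonal := by simp
  off_diagonal := by aesop

end ArtinTits

namespace ArtinTits
noncomputable section
variable {B : Type*}

/-- Twice the canonical bilinear form on simple roots. -/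
def kf (M : CoxeterMatrix B) (s t : B) : ℝ := -(2 * Real.cos (Real.pi / M s t))

lemma kf_self (M : CoxeterMatrix B) (s : B) : kf M s s = 2 := by
  simp [kf, M.diagonal]

lemma kf_symm (M : CoxeterMatrix B) (s t : B) : kf M s t = kf M t s := by
  simp [kf, M.symmetric s t]

lemma kf_two (M : CoxeterMatrix B) {s t : B} (h : M s t = 2) : kf M s t = 0 := by
  simp [kf, h]

open Classical in
/-- The coroot functional. -/
def crt [Fintype B] (M : CoxeterMatrix B) (s : B) : Module.Dual ℝ (B → ℝ) :=
  ∑ t, kf M s t • LinearMap.proj t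

open Classical in
/-- simple root -/
def rt (s : B) : B → ℝ := Pi.single s 1

lemma crt_apply [Fintype B] (M : CoxeterMatrix B) (s : B) (v : B → ℝ) :
    crt M s v = ∑ t, kf M s t * v t := by
  simp [crt]

lemma crt_rt [Fintype B] (M : CoxeterMatrix B) (s t : B) : crt M s (rt t) = kf M s t := by
  classical
  simp [crt_apply, rt, Pi.single_apply]

lemma crt_rt_self [Fintype B] (M : CoxeterMatrix B) (s : B) : crt M s (rt s) = 2 := by
  rw [crt_rt, kf_self]

/-- reflection -/
def rfl' [Fintype B] (M : CoxeterMatrix B) (s : B) : (B → ℝ) ≃ₗ[ℝ] (B → ℝ) :=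
  Module.reflection (crt_rt_self M s)

lemma rfl'_apply [Fintype B] (M : CoxeterMatrix B) (s : B) (v : B → ℝ) :
    rfl' M s v = v - crt M s v • rt s := by
  simp [rfl', Module.reflection_apply]

lemma rfl'_mul_self [Fintype B] (M : CoxeterMatrix B) (s : B) :
    rfl' M s * rfl' M s = 1 := by
  ext1 v
  exact Module.involutive_reflection (crt_rt_self M s) v

open Polynomial Polynomial.Chebyshev in
lemma rfl'_liftable [Fintype B] (M : CoxeterMatrix B) : M.IsLiftable (rfl' M) := by
  intro s t
  by_cases hst : s = t
  · subst hst
    simp [M.diagonal, rfl'_mul_self]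
  have hm1 := M.off_diagonal s t hst
  by_cases h0 : M s t = 0
  · simp [h0]
  by_cases h2 : M s t = 2
  · rw [h2, pow_two]
    have hk := kf_two M h2
    have hk' : kf M t s = 0 := by rw [kf_symm, hk]
    ext1 v
    simp only [LinearEquiv.mul_apply, rfl'_apply, map_sub, map_smul, crt_rt, kf_self, hk, hk']
    simp
    module
  have hm : 3 ≤ M s t := by omega
  set m := M s t with hmdef
  set φ : ℝ := 2 * (Real.pi / m) with hφ
  have hmR : (3:ℝ) ≤ m := by exact_mod_cast hm
  have hmφ : (m:ℝ) * φ = 2 * Real.pi := by rw [hφ]; field_simp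
  have hsin : Real.sin φ ≠ 0 := by
    apply ne_of_gt
    apply Real.sin_pos_of_pos_of_lt_pi
    · positivity
    · nlinarith [Real.pi_pos]
  have ht : 2 * Real.cos φ = crt M s (rt t) * crt M t (rt s) - 2 := by
    rw [crt_rt, crt_rt, kf_symm M t s, kf, ← hmdef, hφ, Real.cos_two_mul]
    ring
  have key := fun k : ℤ => S_two_mul_real_cos φ k
  ext1 v
  have := Module.reflection_mul_reflection_pow_apply (crt_rt_self M s) (crt_rt_self M t) m v
    (2 * Real.cos φ) ht
  rw [show (rfl' M s * rfl' M t) = Module.reflection (crt_rt_self M s) * Module.reflection (crt_rt_self M t) from rfl, this]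
  rcases Nat.even_or_odd' m with ⟨l, hl | hl⟩
  · have e1 : ((m:ℤ) - 2) / 2 = l - 1 := by omega
    have e2 : ((m:ℤ) - 1) / 2 = l - 1 := by omega
    have hz : (S ℝ ((l:ℤ) - 1)).eval (2 * Real.cos φ) = 0 := by
      have := key (l - 1)
      have h3 : (((l:ℤ) - 1 : ℤ) + 1 : ℝ) * φ = Real.pi := by
        rw [hl] at hmφ
        push_cast at hmφ ⊢
        linarith
      rw [h3, Real.sin_pi] at this
      exact (mul_eq_zero.1 this).resolve_right hsin
    rw [e1, e2, hz]
    simp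
  · have e1 : ((m:ℤ) - 1) / 2 = l := by omega
    have e2 : ((m:ℤ) - 3) / 2 = l - 1 := by omega
    have e3 : (m:ℤ) / 2 = l := by omega
    have e4 : ((m:ℤ) - 2) / 2 = l - 1 := by omega
    have hz : (S ℝ (l:ℤ)).eval (2 * Real.cos φ) + (S ℝ ((l:ℤ) - 1)).eval (2 * Real.cos φ) = 0 := by
      have k1 := key l
      have k2 := key (l - 1)
      have h3 : ((l:ℤ) + 1 : ℝ) * φ = 2 * Real.pi - (((l:ℤ) - 1 : ℤ) + 1 : ℝ) * φ := by
        rw [hl] at hmφ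
        push_cast at hmφ ⊢
        linarith
      rw [h3, Real.sin_two_pi_sub] at k1
      have : ((S ℝ (l:ℤ)).eval (2 * Real.cos φ) + (S ℝ ((l:ℤ) - 1)).eval (2 * Real.cos φ)) * Real.sin φ = 0 := by
        rw [add_mul, k1, k2]; ring
      simpa [hsin] using this
    rw [e1, e2, e3, e4, hz]
    simp

/-- geometric representation -/
def rho [Fintype B] (M : CoxeterMatrix B) : M.Group →* ((B → ℝ) ≃ₗ[ℝ] (B → ℝ)) :=
  M.toCoxeterSystem.lift ⟨rfl' M, rfl'_liftable M⟩

lemma rho_simple [Fintype B] (M : CoxeterMatrix B) (s : B) : rho M (M.simple s) = rfl' M s :=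
  M.toCoxeterSystem.lift_apply_simple (rfl'_liftable M) s

lemma rho_WP [Fintype B] (M : CoxeterMatrix B) (X : Set B) (w : M.Group) (hw : w ∈ WP M X)
    (t : B) (ht : t ∉ X) : ∀ v, (rho M w v) t = v t := by
  induction hw using Subgroup.closure_induction with
  | mem x hx =>
    obtain ⟨s, hs, rfl⟩ := hx
    intro v
    have : s ≠ t := fun h => ht (h ▸ hs)
    rw [rho_simple, rfl'_apply]
    simp [rt, Pi.single_apply, this.symm]
  | one => simp
  | mul x y _ _ hx hy => intro v; rw [map_mul, LinearEquiv.mul_apply, hx, hy]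
  | inv x _ hx =>
    intro v
    rw [← hx (rho M x⁻¹ v)]
    rw [← LinearEquiv.mul_apply, ← map_mul]; simp

lemma simple_mem_WP [Fintype B] (M : CoxeterMatrix B) (X : Set B) (t : B)
    (h : M.simple t ∈ WP M X) : t ∈ X := by
  by_contra ht
  have := rho_WP M X _ h t ht (rt t)
  rw [rho_simple, rfl'_apply, crt_rt_self] at this
  simp [rt] at this

lemma kf_ne_zero (M : CoxeterMatrix B) {s t : B} (h2 : M s t ≠ 2) : kf M s t ≠ 0 := by
  by_cases hst : s = t
  · subst hst; simp [kf_self]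
  have hm1 := M.off_diagonal s t hst
  by_cases h0 : M s t = 0
  · simp [kf, h0]
  have hm : (3:ℝ) ≤ M s t := by exact_mod_cast (by omega : 3 ≤ M s t)
  have : 0 < Real.cos (Real.pi / M s t) := by
    apply Real.cos_pos_of_mem_Ioo
    have : 0 < Real.pi / M s t := by positivity
    constructor
    · linarith [Real.pi_pos]
    · apply div_lt_div_of_pos_left Real.pi_pos <;> linarith
  simp only [kf]
  intro h
  linarith

lemma posdef [Fintype B] (M : CoxeterMatrix B) [Finite M.Group]
    (hconn : ConnectedIn M Set.univ) (v : B → ℝ) (hv : v ≠ 0) :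
    0 < ∑ s, v s * ∑ t, kf M s t * v t := by
  classical
  haveI := Fintype.ofFinite M.Group
  let ip : (B → ℝ) →ₗ[ℝ] (B → ℝ) →ₗ[ℝ] ℝ :=
    ∑ w : M.Group, (dotProductBilin ℝ ℝ).compl₁₂ (rho M w).toLinearMap (rho M w).toLinearMap
  have ip_apply : ∀ x y, ip x y = ∑ w : M.Group, ∑ i, rho M w x i * rho M w y i := by
    intro x y
    simp [ip, dotProduct]
  have ip_inv : ∀ u x y, ip (rho M u x) (rho M u y) = ip x y := by
    intro u x y
    rw [ip_apply, ip_apply, ← Equiv.sum_comp (Equiv.mulRight u)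
      (fun w => ∑ i, rho M w x i * rho M w y i)]
    simp
  have ip_pos : ∀ x, x ≠ 0 → 0 < ip x x := by
    intro x hx
    rw [ip_apply]
    have hx' : ∃ i, x i ≠ 0 := by
      by_contra h; push Not at h; exact hx (funext h)
    obtain ⟨i, hi⟩ := hx'
    apply Finset.sum_pos'
    · intro w _; exact Finset.sum_nonneg (fun i _ => mul_self_nonneg _)
    · refine ⟨1, Finset.mem_univ _, ?_⟩
      apply Finset.sum_pos'
      · intro i _; exact mul_self_nonneg _
      · exact ⟨i, Finset.mem_univ _, by simpa using mul_self_pos.2 hi⟩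
  have rt_ne : ∀ s : B, rt s ≠ 0 := by intro s; simp [rt]
  have key : ∀ s x, 2 * ip x (rt s) = crt M s x * ip (rt s) (rt s) := by
    intro s x
    have h := ip_inv (M.simple s) x (rt s)
    rw [rho_simple, rfl'_apply, rfl'_apply, crt_rt_self] at h
    simp only [map_sub, map_smul, LinearMap.sub_apply, LinearMap.smul_apply, smul_eq_mul] at h
    linarith
  have ip_symm : ∀ x y, ip x y = ip y x := by
    intro x y; rw [ip_apply, ip_apply]; simp only [mul_comm]
  have hN : ∀ s t, M s t ≠ 2 → ip (rt s) (rt s) = ip (rt t) (rt t) := by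
    intro s t hst
    have h1 := key s (rt t)
    have h2 := key t (rt s)
    rw [crt_rt] at h1 h2
    rw [ip_symm, h1, kf_symm M t s] at h2
    exact mul_left_cancel₀ (kf_ne_zero M hst) h2
  obtain ⟨s₀, -⟩ : ∃ i, v i ≠ 0 := by
    by_contra h; push Not at h; exact hv (funext h)
  have hN' : ∀ t, ip (rt t) (rt t) = ip (rt s₀) (rt s₀) := by
    intro t
    have := hconn s₀ trivial t trivial
    induction this with
    | refl => rfl
    | tail _ h ih => rw [← ih]; exact (hN _ _ h.2.2.2).symm
  have hpos := ip_pos _ (rt_ne s₀)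
  have hfin : (∑ s, v s * ∑ t, kf M s t * v t) * ip (rt s₀) (rt s₀) = 2 * ip v v := by
    have hvs : v = ∑ s, v s • rt s := by
      ext i; simp [rt, Pi.single_apply]
    calc _ = ∑ s, v s * (2 * ip v (rt s)) := by
            rw [Finset.sum_mul]
            refine Finset.sum_congr rfl fun s _ => ?_
            rw [key, crt_apply, hN' s]; ring
      _ = 2 * ip v (∑ s, v s • rt s) := by
            rw [map_sum, Finset.mul_sum]
            refine Finset.sum_congr rfl fun s _ => ?_
            simp; ring
      _ = _ := by rw [← hvs]
  have := ip_pos v hv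
  by_contra hcon
  push Not at hcon
  nlinarith
end
end ArtinTits

namespace ArtinTits
section
variable {B : Type*}

lemma map_altProd {G H : Type*} [Group G] [Group H] (f : G →* H) (m : ℕ) :
    ∀ a b : G, f (altProd a b m) = altProd (f a) (f b) m := by
  induction m with
  | zero => intro a b; simp [altProd]
  | succ m ih => intro a b; simp [altProd, ih]

/-- Universal property of the Artin group. -/
def artinLift {G : Type*} [Group G] (M : CoxeterMatrix B) (f : B → G)
    (h : ∀ s t, M s t ≠ 0 → altProd (f s) (f t) (M s t) = altProd (f t) (f s) (M s t)) :
    ArtinGroup M →* G :=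
  PresentedGroup.toGroup (f := f) (by
    rintro r ⟨s, t, h0, rfl⟩
    rw [map_mul, map_inv, map_altProd, map_altProd]
    simp [h s t h0])

lemma artinLift_σ {G : Type*} [Group G] (M : CoxeterMatrix B) (f : B → G) (h) (s : B) :
    artinLift M f h (σ M s) = f s := by
  simp [artinLift, σ]

lemma σ_rel (M : CoxeterMatrix B) (s t : B) :
    altProd (σ M s) (σ M t) (M s t) = altProd (σ M t) (σ M s) (M s t) := by
  by_cases h0 : M s t = 0
  · simp [h0, altProd]
  have : PresentedGroup.mk (artinRelationsSet M) (altProd (FreeGroup.of s) (FreeGroup.of t) (M s t) *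
        (altProd (FreeGroup.of t) (FreeGroup.of s) (M s t))⁻¹) = 1 :=
    PresentedGroup.one_of_mem ⟨s, t, h0, rfl⟩
  rw [map_mul, map_inv, map_altProd, map_altProd, mul_inv_eq_one] at this
  exact this

lemma altProd_invol {G : Type*} [Group G] (m : ℕ) : ∀ a b : G, a * a = 1 → b * b = 1 →
    altProd a b m = (a * b) ^ m * altProd b a m := by
  induction m with
  | zero => intro a b _ _; simp [altProd]
  | succ m ih =>
    intro a b ha hb
    rw [show altProd a b (m+1) = a * altProd b a m from rfl,
      show altProd b a (m+1) = b * altProd a b m from rfl, ih b a hb ha, pow_succ]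
    have : a * (b * a) ^ m = (a * b) ^ m * a := by
      have := mul_pow_mul a b m
      rw [← this]
    rw [← mul_assoc, this]
    rw [mul_assoc, mul_assoc, mul_assoc, ← mul_assoc b b, hb, one_mul]

/-- The canonical projection. -/
def toW (M : CoxeterMatrix B) : ArtinGroup M →* M.Group :=
  artinLift M M.simple (by
    intro s t _
    have hs := M.toCoxeterSystem.simple_mul_simple_self s
    have ht := M.toCoxeterSystem.simple_mul_simple_self t
    have hst := M.toCoxeterSystem.simple_mul_simple_pow s t
    simp only [CoxeterMatrix.toCoxeterSystem_simple] at hs ht hst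
    rw [altProd_invol _ _ _ hs ht, hst, one_mul])

lemma toW_σ (M : CoxeterMatrix B) (s : B) : toW M (σ M s) = M.simple s := artinLift_σ _ _ _ _

lemma altProd_odd {G : Type*} [Group G] (k : ℕ) : ∀ a b : G,
    a * altProd b a (2 * k + 1) = altProd a b (2 * k + 1) * b := by
  induction k with
  | zero => intro a b; simp [altProd]
  | succ k ih =>
    intro a b
    have h : ∀ x y : G, altProd x y (2 * (k+1) + 1) = x * (y * altProd x y (2 * k + 1)) := by
      intro x y; rfl
    rw [h, h, mul_assoc, mul_assoc, ← ih a b]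

/-- joined by odd edges -/
def OddAdj (M : CoxeterMatrix B) (s t : B) : Prop := Odd (M s t)

lemma conj_of_odd (M : CoxeterMatrix B) {s t : B} (h : Relation.ReflTransGen (OddAdj M) s t) :
    ∃ g : ArtinGroup M, g⁻¹ * σ M s * g = σ M t := by
  induction h with
  | refl => exact ⟨1, by simp⟩
  | @tail b c _ hbc ih =>
    obtain ⟨g, hg⟩ := ih
    obtain ⟨k, hk⟩ := hbc
    have h1 := altProd_odd k (σ M b) (σ M c)
    have h2 := σ_rel M b c
    rw [hk] at h2
    refine ⟨g * altProd (σ M b) (σ M c) (2 * k + 1), ?_⟩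
    rw [mul_inv_rev]
    rw [← h2] at h1
    calc _ = (altProd (σ M b) (σ M c) (2 * k + 1))⁻¹ * (g⁻¹ * σ M s * g) *
          altProd (σ M b) (σ M c) (2 * k + 1) := by group
      _ = _ := by rw [hg, mul_assoc, h1]; group

lemma not_stable [Finite B] (M : CoxeterMatrix B) (X : Set B) {s t : B} (hs : s ∈ X) (ht : t ∈ X)
    (hr : ¬ ReachIn M X s t) (h : Relation.ReflTransGen (OddAdj M) s t) :
    ¬ IsConjugacyStable (AP M X) := by
  have := Fintype.ofFinite B
  intro hst
  obtain ⟨h, hh, hc⟩ := hst (σ M s) (σ M t) (Subgroup.subset_closure ⟨s, hs, rfl⟩)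
    (Subgroup.subset_closure ⟨t, ht, rfl⟩) (conj_of_odd M h)
  have hv : toW M h ∈ WP M X := by
    have : (AP M X).map (toW M) ≤ WP M X := by
      rw [AP, MonoidHom.map_closure, WP, ← Set.image_comp]
      apply Subgroup.closure_mono
      rintro _ ⟨x, hx, rfl⟩
      exact ⟨x, hx, (toW_σ M x).symm⟩
    exact this ⟨h, hh, rfl⟩
  have hc' : (toW M h)⁻¹ * M.simple s * toW M h = M.simple t := by
    rw [← toW_σ M t, ← hc]; simp [toW_σ]
  set X₁ : Set B := {y | y ∈ X ∧ ReachIn M X s y} with hX₁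
  have hcomm : ∀ x ∈ X, x ∉ X₁ → ∀ y ∈ X₁, M.simple x * M.simple y = M.simple y * M.simple x := by
    intro x hx hx1 y hy
    have hxy : M x y = 2 := by
      by_contra h2
      apply hx1
      refine ⟨hx, Relation.ReflTransGen.tail hy.2 ⟨hy.1, hx, ?_, ?_⟩⟩
      · rintro rfl; exact hx1 hy
      · rwa [M.symmetric]
    have h1 := M.toCoxeterSystem.simple_mul_simple_self x
    have h2 := M.toCoxeterSystem.simple_mul_simple_self y
    have h3 := M.toCoxeterSystem.simple_mul_simple_pow x y
    simp only [CoxeterMatrix.toCoxeterSystem_simple] at h1 h2 h3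
    have := altProd_invol 2 _ _ h1 h2
    rw [hxy] at h3
    rw [h3] at this
    simpa [altProd] using this
  have hnorm : ∀ v ∈ WP M X, ∀ u ∈ WP M X₁, v⁻¹ * u * v ∈ WP M X₁ := by
    have hmem : ∀ x ∈ X, ∀ u ∈ WP M X₁, (M.simple x)⁻¹ * u * M.simple x ∈ WP M X₁ := by
      intro x hx u hu
      by_cases hx1 : x ∈ X₁
      · have hx' : M.simple x ∈ WP M X₁ := Subgroup.subset_closure ⟨x, hx1, rfl⟩
        exact mul_mem (mul_mem (inv_mem hx') hu) hx'
      · have : u * M.simple x = M.simple x * u := by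
          induction hu using Subgroup.closure_induction with
          | mem u hu => obtain ⟨y, hy, rfl⟩ := hu; exact (hcomm x hx hx1 y hy).symm
          | one => simp
          | mul a b _ _ ha hb => rw [mul_assoc, hb, ← mul_assoc, ha, mul_assoc]
          | inv a _ ha => exact (Commute.inv_left (show Commute a _ from ha)).eq
        rw [mul_assoc, this]; simpa using hu
    have hinv : ∀ x, (M.simple x)⁻¹ = M.simple x := by
      intro x
      have h1 := M.toCoxeterSystem.inv_simple x
      simpa only [CoxeterMatrix.toCoxeterSystem_simple] using h1
    suffices hsuff : ∀ v ∈ WP M X, (∀ u ∈ WP M X₁, v⁻¹ * u * v ∈ WP M X₁) ∧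
        (∀ u ∈ WP M X₁, v * u * v⁻¹ ∈ WP M X₁) from fun v hv => (hsuff v hv).1
    intro v hv
    induction hv using Subgroup.closure_induction with
    | mem v hv =>
      obtain ⟨x, hx, rfl⟩ := hv
      have := hmem x hx
      refine ⟨this, ?_⟩
      rw [hinv] at *
      exact this
    | one => simp
    | mul a b _ _ ha hb =>
      refine ⟨fun u hu => ?_, fun u hu => ?_⟩
      · have := hb.1 _ (ha.1 u hu)
        convert this using 1; group
      · have := ha.2 _ (hb.2 u hu)
        convert this using 1; group
    | inv a _ ha => exact ⟨by simpa using ha.2, by simpa using ha.1⟩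
  have h1 : M.simple t ∈ WP M X₁ := by
    rw [← hc']
    exact hnorm _ hv _ (Subgroup.subset_closure ⟨s, ⟨hs, Relation.ReflTransGen.refl⟩, rfl⟩)
  exact hr (simple_mem_WP M X₁ t h1).2

end
end ArtinTits

namespace ArtinTits
section Braid
variable {G : Type*} [Group G] (τ : ℕ → G)

/-- label of crossing `i` after removing strand `j` -/
def fl (i j : ℕ) : G := if j < i then τ (i - 1) else if j ≤ i + 1 then 1 else τ i

/-- transposition -/
def sw (i j : ℕ) : ℕ := if j = i then i + 1 else if j = i + 1 then i else j

lemma sw_sw (i j : ℕ) : sw i (sw i j) = j := by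
  unfold sw; split_ifs <;> omega

/-- the monomial permutation attached to crossing `i` -/
def Pm (i : ℕ) : Equiv.Perm (ℕ × G) where
  toFun p := (sw i p.1, fl τ i p.1 * p.2)
  invFun p := (sw i p.1, (fl τ i (sw i p.1))⁻¹ * p.2)
  left_inv p := by simp [sw_sw]
  right_inv p := by simp [sw_sw]

lemma Pm_lt {i j : ℕ} (h : j < i) (x : G) : Pm τ i (j, x) = (j, τ (i-1) * x) := by
  simp only [Pm, Equiv.coe_fn_mk, sw, fl]
  rw [if_neg (by omega), if_neg (by omega), if_pos h]

lemma Pm_gt {i j : ℕ} (h : i + 1 < j) (x : G) : Pm τ i (j, x) = (j, τ i * x) := by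
  simp only [Pm, Equiv.coe_fn_mk, sw, fl]
  rw [if_neg (by omega), if_neg (by omega), if_neg (by omega), if_neg (by omega)]

lemma Pm_eq (i : ℕ) (x : G) : Pm τ i (i, x) = (i + 1, x) := by
  simp [Pm, sw, fl]

lemma Pm_succ (i : ℕ) (x : G) : Pm τ i (i + 1, x) = (i, x) := by
  simp [Pm, sw, fl]

lemma Pm_braid (i : ℕ) (h : τ i * τ (i+1) * τ i = τ (i+1) * τ i * τ (i+1))
    (h' : 1 ≤ i → τ (i-1) * τ i * τ (i-1) = τ i * τ (i-1) * τ i) :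
    Pm τ i * Pm τ (i+1) * Pm τ i = Pm τ (i+1) * Pm τ i * Pm τ (i+1) := by
  ext1 ⟨j, x⟩
  simp only [Equiv.Perm.mul_apply]
  have hj5 : j < i ∨ j = i ∨ j = i + 1 ∨ j = i + 1 + 1 ∨ i + 1 + 1 < j := by omega
  rcases hj5 with hj | rfl | rfl | rfl | hj
  · simp only [Pm_lt τ hj, Pm_lt τ (show j < i + 1 by omega), Nat.add_sub_cancel, ← mul_assoc]
    rw [h' (by omega)]
  · simp only [Pm_eq, Pm_gt τ (show j + 1 < j + 1 + 1 by omega), Pm_lt τ (show j < j + 1 by omega),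
      Nat.add_sub_cancel]
  · simp only [Pm_eq, Pm_succ, Pm_gt τ (show i + 1 < i + 1 + 1 by omega),
      Pm_lt τ (show i < i + 1 by omega), Nat.add_sub_cancel]
  · simp only [Pm_succ, Pm_gt τ (show i + 1 < i + 1 + 1 by omega),
      Pm_lt τ (show i < i + 1 by omega), Nat.add_sub_cancel]
  · simp only [Pm_gt τ hj, Pm_gt τ (show i + 1 < j by omega), ← mul_assoc]
    rw [h]

lemma Pm_comm {i j : ℕ} (hij : i + 1 < j)
    (h : ∀ i j, i + 1 < j → τ i * τ j = τ j * τ i) :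
    Pm τ i * Pm τ j = Pm τ j * Pm τ i := by
  ext1 ⟨k, x⟩
  simp only [Equiv.Perm.mul_apply]
  have hk7 : k < i ∨ k = i ∨ k = i + 1 ∨ (i + 1 < k ∧ k < j) ∨ k = j ∨ k = j + 1 ∨ j + 1 < k := by
    omega
  rcases hk7 with hk | rfl | rfl | ⟨hk, hk'⟩ | rfl | rfl | hk
  · simp only [Pm_lt τ hk, Pm_lt τ (show k < j by omega), ← mul_assoc]
    rw [h _ _ (by omega)]
  · simp only [Pm_eq, Pm_lt τ (show k < j by omega), Pm_lt τ (show k + 1 < j by omega)]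
  · simp only [Pm_succ, Pm_lt τ (show i < j by omega), Pm_lt τ (show i + 1 < j by omega)]
  · simp only [Pm_gt τ hk, Pm_lt τ hk', ← mul_assoc]
    rw [h _ _ (by omega)]
  · simp only [Pm_eq, Pm_gt τ hij, Pm_gt τ (show i + 1 < k + 1 by omega)]
  · simp only [Pm_succ, Pm_gt τ hij, Pm_gt τ (show i + 1 < j + 1 by omega)]
  · simp only [Pm_gt τ hk, Pm_gt τ (show i + 1 < k by omega), ← mul_assoc]
    rw [h _ _ (by omega)]

/-- subgroup of braids on the first `k` strands -/
def Br (k : ℕ) : Subgroup G := Subgroup.closure (τ '' {i | i + 1 < k})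

lemma Br_mono {k l : ℕ} (h : k ≤ l) : Br τ k ≤ Br τ l :=
  Subgroup.closure_mono (Set.image_mono fun i (hi : i + 1 < k) => by
    simp only [Set.mem_ofPred_eq]; omega)

lemma mem_Br {i k : ℕ} (h : i + 1 < k) : τ i ∈ Br τ k := Subgroup.subset_closure ⟨i, h, rfl⟩

lemma fl_mem {i j k : ℕ} (hi : i + 1 < k) (hj : j < k) : fl τ i j ∈ Br τ (k - 1) := by
  unfold fl
  split_ifs
  · exact mem_Br τ (by omega)
  · exact one_mem _
  · exact mem_Br τ (by omega)

lemma sw_lt {i j k : ℕ} (hi : i + 1 < k) (hj : j < k) : sw i j < k := by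
  unfold sw; split_ifs <;> omega

variable (N : ℕ) (D : G →* Equiv.Perm (ℕ × G)) (hD : ∀ i < N, D (τ i) = Pm τ i)

include hD in
lemma Br_action {k : ℕ} (hk : k ≤ N + 1) (g : G) (hg : g ∈ Br τ k) :
    ∀ j, ∃ j' y, (∀ x, D g (j, x) = (j', y * x)) ∧ (j < k → j' < k ∧ y ∈ Br τ (k-1)) ∧
      (k ≤ j → j' = j ∧ y = g) := by
  rw [Br, ← Subgroup.mem_toSubmonoid, Subgroup.closure_toSubmonoid] at hg
  induction hg using Submonoid.closure_induction with
  | mem g hg =>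
    rcases hg with ⟨i, hi, rfl⟩ | hg
    · simp only [Set.mem_ofPred_eq] at hi
      intro j
      refine ⟨sw i j, fl τ i j, fun x => ?_, fun hj => ⟨sw_lt hi hj, fl_mem τ hi hj⟩, fun hj => ?_⟩
      · rw [hD i (by omega)]; rfl
      · unfold sw fl
        rw [if_neg (by omega), if_neg (by omega), if_neg (by omega), if_neg (by omega)]
        simp
    · obtain ⟨i, hi, hig⟩ := hg
      obtain rfl : g = (τ i)⁻¹ := by rw [hig, inv_inv]
      simp only [Set.mem_ofPred_eq] at hi
      intro j
      refine ⟨sw i j, (fl τ i (sw i j))⁻¹, fun x => ?_,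
        fun hj => ⟨sw_lt hi hj, inv_mem (fl_mem τ hi (sw_lt hi hj))⟩, fun hj => ?_⟩
      · rw [map_inv, hD i (by omega)]; rfl
      · have : sw i j = j := by unfold sw; rw [if_neg (by omega), if_neg (by omega)]
        rw [this]
        unfold fl
        rw [if_neg (by omega), if_neg (by omega)]
        simp
  | one => intro j; exact ⟨j, 1, by simp, fun h => ⟨h, one_mem _⟩, by simp⟩
  | mul g h _ _ ihg ihh =>
    intro j
    obtain ⟨j', y, h1, h2, h3⟩ := ihh j
    obtain ⟨j'', y', h1', h2', h3'⟩ := ihg j'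
    refine ⟨j'', y' * y, fun x => ?_, fun hj => ?_, fun hj => ?_⟩
    · rw [map_mul, Equiv.Perm.mul_apply, h1, h1', mul_assoc]
    · have a := h2 hj
      have b := h2' a.1
      exact ⟨b.1, mul_mem b.2 a.2⟩
    · obtain ⟨rfl, rfl⟩ := h3 hj
      obtain ⟨rfl, rfl⟩ := h3' hj
      exact ⟨rfl, rfl⟩

include hD in
lemma Br_half {m n : ℕ} (hn : n ≤ N + 1) (hm : m + 1 ≤ n) (a b g : G) (ha : a ∈ Br τ m)
    (hb : b ∈ Br τ m) (hg : g ∈ Br τ n) (hc : g⁻¹ * a * g = b) :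
    ∃ h ∈ Br τ (n-1), ∃ a', (a' = a ∨ (a' ∈ Br τ (m-1) ∧ 0 < m)) ∧ h⁻¹ * a' * h = b := by
  have hag : a * g = g * b := by rw [← hc]; group
  obtain ⟨j', y, h1, h2, -⟩ := Br_action τ N D hD hn g hg (n-1)
  obtain ⟨j1, b', h3, -, h4⟩ := Br_action τ N D hD (by omega : m ≤ N+1) b hb (n-1)
  obtain ⟨rfl, rfl⟩ := h4 (by omega)
  obtain ⟨j2, z, h5, h6, h7⟩ := Br_action τ N D hD (by omega : m ≤ N+1) a ha j'
  have h2 := h2 (by omega)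
  have key : D (a * g) (n-1, 1) = D (g * b') (n-1, 1) := by rw [hag]
  rw [map_mul, map_mul, Equiv.Perm.mul_apply, Equiv.Perm.mul_apply, h1, h5, h3, h1] at key
  simp only [mul_one, Prod.mk.injEq] at key
  refine ⟨y, h2.2, z, ?_, ?_⟩
  · by_cases hj : j' < m
    · exact Or.inr ⟨(h6 hj).2, by omega⟩
    · exact Or.inl (h7 (by omega)).2
  · rw [mul_assoc, key.2]; group

include hD in
lemma Br_step {n : ℕ} (hn : n ≤ N + 1) (m : ℕ) : ∀ (_ : m + 1 ≤ n) (a b g : G) (_ : a ∈ Br τ m)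
    (_ : b ∈ Br τ m) (_ : g ∈ Br τ n) (_ : g⁻¹ * a * g = b),
    ∃ h ∈ Br τ (n-1), h⁻¹ * a * h = b := by
  induction m with
  | zero =>
    intro hm a b g ha hb hg hc
    obtain ⟨h, hh, a', h1 | h1, h2⟩ := Br_half τ N D hD hn hm a b g ha hb hg hc
    · exact ⟨h, hh, h1 ▸ h2⟩
    · omega
  | succ m ih =>
    intro hm a b g ha hb hg hc
    obtain ⟨h, hh, a', h1 | ⟨h1, -⟩, h2⟩ := Br_half τ N D hD hn hm a b g ha hb hg hc
    · exact ⟨h, hh, h1 ▸ h2⟩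
    obtain ⟨k, hk, b', h3 | ⟨h3, -⟩, h4⟩ := Br_half τ N D hD hn hm b a g⁻¹ hb ha (inv_mem hg)
      (by rw [← hc]; group)
    · subst h3
      refine ⟨k⁻¹, inv_mem hk, ?_⟩
      rw [← h4]; group
    have hle := Br_mono τ (show n - 1 ≤ n by omega)
    obtain ⟨l, hl, h5⟩ := ih (by omega) a' b' (h * g⁻¹ * k⁻¹) h1 h3
      (mul_mem (mul_mem (hle hh) (inv_mem hg)) (inv_mem (hle hk))) (by
        have e1 : a' = h * b * h⁻¹ := by rw [← h2]; group
        have e2 : b' = k * a * k⁻¹ := by rw [← h4]; group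
        rw [e1, e2, ← hc]; group)
    refine ⟨k⁻¹ * l⁻¹ * h, mul_mem (mul_mem (inv_mem hk) (inv_mem hl)) hh, ?_⟩
    rw [← h2, ← h4, ← h5]; group

include hD in
lemma Br_stable {m n : ℕ} (hmn : m ≤ n) : ∀ (_ : n ≤ N + 1) (a b g : G) (_ : a ∈ Br τ m)
    (_ : b ∈ Br τ m) (_ : g ∈ Br τ n) (_ : g⁻¹ * a * g = b),
    ∃ h ∈ Br τ m, h⁻¹ * a * h = b := by
  induction n, hmn using Nat.le_induction with
  | base => intro _ a b g _ _ hg hc; exact ⟨g, hg, hc⟩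
  | succ n hmn ih =>
    intro hn a b g ha hb hg hc
    obtain ⟨h, hh, hc'⟩ := Br_step τ N D hD hn m (by omega) a b g ha hb hg hc
    exact ih (by omega) a b h ha hb hh hc'

/-- `τ 0 ⋯ τ (k-1)` -/
def cc : ℕ → G
  | 0 => 1
  | k + 1 => cc k * τ k

variable (hcomm : ∀ i j, i + 1 < j → τ i * τ j = τ j * τ i)
  (hbraid : ∀ i, i + 1 < N → τ i * τ (i+1) * τ i = τ (i+1) * τ i * τ (i+1))

include hcomm in
lemma cc_comm (k j : ℕ) (h : k < j) : cc τ k * τ j = τ j * cc τ k := by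
  induction k with
  | zero => simp [cc]
  | succ k ih => rw [cc, mul_assoc, hcomm k j (by omega), ← mul_assoc, ih (by omega), mul_assoc]

include hcomm hbraid in
lemma cc_shift (k : ℕ) (hk : k ≤ N) (i : ℕ) (hi : i + 1 < k) :
    cc τ k * τ i = τ (i + 1) * cc τ k := by
  induction k with
  | zero => omega
  | succ k ih =>
    rcases eq_or_lt_of_le (show i + 1 ≤ k by omega) with rfl | h
    · rw [cc, cc]
      calc cc τ i * τ i * τ (i+1) * τ i = cc τ i * (τ i * τ (i+1) * τ i) := by group
        _ = cc τ i * τ (i+1) * τ i * τ (i+1) := by rw [hbraid i (by omega)]; group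
        _ = _ := by rw [cc_comm τ hcomm i (i+1) (by omega)]; group
    · rw [cc, mul_assoc, ← hcomm i k (by omega), ← mul_assoc, ih (by omega) h, mul_assoc]

lemma cc_mem (k : ℕ) (hk : k ≤ N) : cc τ k ∈ Br τ (N + 1) := by
  induction k with
  | zero => exact one_mem _
  | succ k ih => exact mul_mem (ih (by omega)) (mem_Br τ (by omega))

include hcomm hbraid in
lemma cc_pow_shift (d i : ℕ) (hi : i + d < N) :
    (cc τ N) ^ d * τ i * ((cc τ N) ^ d)⁻¹ = τ (i + d) := by
  induction d with
  | zero => simp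
  | succ d ih =>
    have h1 := ih (by omega)
    have h2 := cc_shift τ N hcomm hbraid N le_rfl (i + d) (by omega)
    calc _ = cc τ N * ((cc τ N) ^ d * τ i * ((cc τ N) ^ d)⁻¹) * (cc τ N)⁻¹ := by
            rw [pow_succ']; group
      _ = _ := by rw [h1, h2, ← add_assoc]; group

include hD hcomm hbraid in
lemma interval_stable (d l : ℕ) (hdl : d + l ≤ N) (a b g : G)
    (ha : a ∈ Subgroup.closure (τ '' {i | d ≤ i ∧ i < d + l}))
    (hb : b ∈ Subgroup.closure (τ '' {i | d ≤ i ∧ i < d + l}))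
    (hg : g ∈ Br τ (N+1)) (hc : g⁻¹ * a * g = b) :
    ∃ h ∈ Subgroup.closure (τ '' {i | d ≤ i ∧ i < d + l}), h⁻¹ * a * h = b := by
  set c := (cc τ N) ^ d with hcdef
  have hcm : c ∈ Br τ (N+1) := pow_mem (cc_mem τ N N le_rfl) d
  have hI : Subgroup.closure (τ '' {i | d ≤ i ∧ i < d + l}) =
      (Br τ (l+1)).map (MulAut.conj c).toMonoidHom := by
    rw [Br, MonoidHom.map_closure]
    congr 1
    ext x
    constructor
    · rintro ⟨i, ⟨h1, h2⟩, rfl⟩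
      refine ⟨τ (i - d), ⟨i - d, by simp only [Set.mem_ofPred_eq]; omega, rfl⟩, ?_⟩
      have := cc_pow_shift τ N hcomm hbraid d (i - d) (by omega)
      rw [show i - d + d = i by omega] at this
      simpa using this
    · rintro ⟨_, ⟨i, h1, rfl⟩, rfl⟩
      simp only [Set.mem_ofPred_eq] at h1
      refine ⟨i + d, by simp only [Set.mem_ofPred_eq]; omega, ?_⟩
      have := cc_pow_shift τ N hcomm hbraid d i (by omega)
      simpa using this.symm
  rw [hI] at ha hb ⊢
  obtain ⟨a, ha, rfl⟩ := ha
  obtain ⟨b, hb, rfl⟩ := hb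
  simp only [MulEquiv.coe_toMonoidHom, MulAut.conj_apply] at hc
  obtain ⟨h, hh, hc'⟩ := Br_stable τ N D hD (show l + 1 ≤ N + 1 by omega) le_rfl a b (c⁻¹ * g * c)
    ha hb (mul_mem (mul_mem (inv_mem hcm) hg) hcm) (by
      have : b = c⁻¹ * (g⁻¹ * (c * a * c⁻¹) * g) * c := by rw [hc]; group
      rw [this]; group)
  refine ⟨c * h * c⁻¹, ⟨h, hh, by simp⟩, ?_⟩
  simp only [MulEquiv.coe_toMonoidHom, MulAut.conj_apply]
  rw [← hc']; group

end Braid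
end ArtinTits

namespace ArtinTits
section
variable {B : Type*}

lemma altProd_one_left {G : Type*} [Group G] (x : G) (k : ℕ) :
    altProd 1 x (2 * k) = x ^ k ∧ altProd x 1 (2 * k) = x ^ k := by
  induction k with
  | zero => simp [altProd]
  | succ k ih =>
    have h : ∀ a b : G, altProd a b (2 * (k + 1)) = a * (b * altProd a b (2 * k)) := fun a b => rfl
    rw [h, h, ih.1, ih.2, pow_succ']
    simp

lemma altProd_self_comm {G : Type*} [Group G] {x y : G} (k : ℕ) (h : x = y) :
    altProd x y k = altProd y x k := by rw [h]

open Classical in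
/-- kill the generators outside `C` -/
noncomputable def ret (M : CoxeterMatrix B) (C : Set B)
    (hC : ∀ s t, s ∈ C → t ∉ C → Even (M s t)) : ArtinGroup M →* ArtinGroup M :=
  artinLift M (fun s => if s ∈ C then σ M s else 1) (by
    intro s t _
    by_cases hs : s ∈ C <;> by_cases ht : t ∈ C
    · simp only [hs, ht, if_true]; exact σ_rel M s t
    · simp only [hs, ht, if_true, if_false]
      obtain ⟨k, hk⟩ := hC s t hs ht
      rw [hk, ← two_mul, (altProd_one_left _ k).1, (altProd_one_left _ k).2]
    · simp only [hs, ht, if_true, if_false]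
      obtain ⟨k, hk⟩ := hC t s ht hs
      rw [M.symmetric, hk, ← two_mul, (altProd_one_left _ k).1, (altProd_one_left _ k).2]
    · simp only [hs, ht, if_false])

open Classical in
lemma ret_σ (M : CoxeterMatrix B) (C : Set B) (hC) (s : B) :
    ret M C hC (σ M s) = if s ∈ C then σ M s else 1 := artinLift_σ _ _ _ _

lemma ret_id (M : CoxeterMatrix B) (C : Set B) (hC) (Y : Set B) (hY : Y ⊆ C) (a : ArtinGroup M)
    (ha : a ∈ AP M Y) : ret M C hC a = a := by
  induction ha using Subgroup.closure_induction with
  | mem x hx => obtain ⟨y, hy, rfl⟩ := hx; rw [ret_σ, if_pos (hY hy)]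
  | one => simp
  | mul a b _ _ ha hb => rw [map_mul, ha, hb]
  | inv a _ ha => rw [map_inv, ha]

lemma ret_one (M : CoxeterMatrix B) (C : Set B) (hC) (Y : Set B) (hY : ∀ y ∈ Y, y ∉ C)
    (a : ArtinGroup M) (ha : a ∈ AP M Y) : ret M C hC a = 1 := by
  induction ha using Subgroup.closure_induction with
  | mem x hx => obtain ⟨y, hy, rfl⟩ := hx; rw [ret_σ, if_neg (hY y hy)]
  | one => simp
  | mul a b _ _ ha hb => rw [map_mul, ha, hb, mul_one]
  | inv a _ ha => rw [map_inv, ha, inv_one]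

lemma artin_closure (M : CoxeterMatrix B) : AP M Set.univ = ⊤ := by
  rw [AP, Set.image_univ]
  exact PresentedGroup.closure_range_of _

lemma ret_mem (M : CoxeterMatrix B) (C : Set B) (hC) (a : ArtinGroup M) :
    ret M C hC a ∈ AP M C := by
  have ha : a ∈ AP M Set.univ := by rw [artin_closure]; trivial
  induction ha using Subgroup.closure_induction with
  | mem x hx =>
    obtain ⟨y, -, rfl⟩ := hx
    rw [ret_σ]
    split_ifs with h
    · exact Subgroup.subset_closure ⟨y, h, rfl⟩
    · exact one_mem _
  | one => simp
  | mul a b _ _ ha hb => rw [map_mul]; exact mul_mem ha hb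
  | inv a _ ha => rw [map_inv]; exact inv_mem ha

lemma σ_comm (M : CoxeterMatrix B) {s t : B} (h : M s t = 2) : Commute (σ M s) (σ M t) := by
  have := σ_rel M s t
  rw [h] at this
  simp only [altProd, mul_one] at this
  exact this

lemma AP_comm (M : CoxeterMatrix B) (X Y : Set B) (h : ∀ x ∈ X, ∀ y ∈ Y, M x y = 2)
    (a b : ArtinGroup M) (ha : a ∈ AP M X) (hb : b ∈ AP M Y) : Commute a b := by
  have h1 : AP M X ≤ Subgroup.centralizer (AP M Y : Set (ArtinGroup M)) := by
    rw [AP, AP, Subgroup.centralizer_closure, Subgroup.closure_le]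
    rintro _ ⟨x, hx, rfl⟩
    rw [SetLike.mem_coe, Subgroup.mem_centralizer_iff]
    rintro _ ⟨y, hy, rfl⟩
    exact (σ_comm M (h x hx y hy)).symm.eq
  exact (Subgroup.mem_centralizer_iff.1 (h1 ha) b hb).symm

/-- `A_X` conjugacy stable with respect to conjugators in `A_C`. -/
def RelStable (M : CoxeterMatrix B) (X C : Set B) : Prop :=
  ∀ a b g, a ∈ AP M X → b ∈ AP M X → g ∈ AP M C → g⁻¹ * a * g = b →
    ∃ h ∈ AP M X, h⁻¹ * a * h = b

lemma stable_split (M : CoxeterMatrix B) (C : Set B)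
    (hC : ∀ s t, s ∈ C → t ∉ C → Even (M s t)) (X₁ X₂ : Set B) (h₁ : X₁ ⊆ C) (h₂ : X₂ ⊆ Cᶜ)
    (hcomm : ∀ x ∈ X₁, ∀ y ∈ X₂, M x y = 2)
    (hs₁ : RelStable M X₁ C) (hs₂ : RelStable M X₂ Cᶜ) : IsConjugacyStable (AP M (X₁ ∪ X₂)) := by
  have hC' : ∀ s t, s ∈ Cᶜ → t ∉ Cᶜ → Even (M s t) := by
    intro s t hs ht
    rw [M.symmetric]
    exact hC t s (by simpa using ht) hs
  have cm := fun a b => AP_comm M X₁ X₂ hcomm a b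
  have dec : ∀ a ∈ AP M (X₁ ∪ X₂), ∃ a₁ ∈ AP M X₁, ∃ a₂ ∈ AP M X₂, a = a₁ * a₂ := by
    intro a ha
    induction ha using Subgroup.closure_induction with
    | mem x hx =>
      obtain ⟨y, hy | hy, rfl⟩ := hx
      · exact ⟨σ M y, Subgroup.subset_closure ⟨y, hy, rfl⟩, 1, one_mem _, by simp⟩
      · exact ⟨1, one_mem _, σ M y, Subgroup.subset_closure ⟨y, hy, rfl⟩, by simp⟩
    | one => exact ⟨1, one_mem _, 1, one_mem _, by simp⟩
    | mul a b _ _ ha hb =>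
      obtain ⟨a₁, ha₁, a₂, ha₂, rfl⟩ := ha
      obtain ⟨b₁, hb₁, b₂, hb₂, rfl⟩ := hb
      refine ⟨a₁ * b₁, mul_mem ha₁ hb₁, a₂ * b₂, mul_mem ha₂ hb₂, ?_⟩
      have := (cm b₁ a₂ hb₁ ha₂).eq
      calc _ = a₁ * (a₂ * b₁) * b₂ := by group
        _ = _ := by rw [← this]; group
    | inv a _ ha =>
      obtain ⟨a₁, ha₁, a₂, ha₂, rfl⟩ := ha
      refine ⟨a₁⁻¹, inv_mem ha₁, a₂⁻¹, inv_mem ha₂, ?_⟩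
      rw [(cm a₁ a₂ ha₁ ha₂).eq, mul_inv_rev]
  have hX₁ : ∀ y ∈ X₁, y ∉ Cᶜ := fun y hy => by simpa using h₁ hy
  have hX₂ : ∀ y ∈ X₂, y ∉ C := fun y hy => h₂ hy
  rintro a b ha hb ⟨g, hg⟩
  obtain ⟨a₁, ha₁, a₂, ha₂, rfl⟩ := dec a ha
  obtain ⟨b₁, hb₁, b₂, hb₂, rfl⟩ := dec b hb
  have e1 := congrArg (ret M C hC) hg
  simp only [map_mul, map_inv, ret_id M C hC X₁ h₁ a₁ ha₁, ret_id M C hC X₁ h₁ b₁ hb₁,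
    ret_one M C hC X₂ hX₂ a₂ ha₂, ret_one M C hC X₂ hX₂ b₂ hb₂, mul_one] at e1
  have e2 := congrArg (ret M Cᶜ hC') hg
  simp only [map_mul, map_inv, ret_id M Cᶜ hC' X₂ h₂ a₂ ha₂, ret_id M Cᶜ hC' X₂ h₂ b₂ hb₂,
    ret_one M Cᶜ hC' X₁ hX₁ a₁ ha₁, ret_one M Cᶜ hC' X₁ hX₁ b₁ hb₁, one_mul] at e2
  obtain ⟨k₁, hk₁, e3⟩ := hs₁ a₁ b₁ _ ha₁ hb₁ (ret_mem M C hC g) e1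
  obtain ⟨k₂, hk₂, e4⟩ := hs₂ a₂ b₂ _ ha₂ hb₂ (ret_mem M Cᶜ hC' g) e2
  have m₁ : AP M X₁ ≤ AP M (X₁ ∪ X₂) :=
    Subgroup.closure_mono (Set.image_mono Set.subset_union_left)
  have m₂ : AP M X₂ ≤ AP M (X₁ ∪ X₂) :=
    Subgroup.closure_mono (Set.image_mono Set.subset_union_right)
  refine ⟨k₁ * k₂, mul_mem (m₁ hk₁) (m₂ hk₂), ?_⟩
  rw [← e3, ← e4]
  have c1 := (cm k₁ a₂ hk₁ ha₂).eq
  have c2 := (cm _ k₂ (mul_mem (mul_mem (inv_mem hk₁) ha₁) hk₁) hk₂).eq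
  calc _ = k₂⁻¹ * k₁⁻¹ * a₁ * (a₂ * k₁) * k₂ := by group
    _ = k₂⁻¹ * (k₁⁻¹ * a₁ * k₁) * a₂ * k₂ := by rw [← c1]; group
    _ = k₂⁻¹ * ((k₁⁻¹ * a₁ * k₁) * k₂) * (k₂⁻¹ * a₂ * k₂) := by group
    _ = _ := by rw [c2]; group

lemma relStable_self (M : CoxeterMatrix B) (X : Set B) : RelStable M X X :=
  fun _ _ g _ _ hg hc => ⟨g, hg, hc⟩

/-- exponent sum -/
def expo (M : CoxeterMatrix B) : ArtinGroup M →* Multiplicative ℤ :=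
  artinLift M (fun _ => Multiplicative.ofAdd 1) (fun _ _ _ => rfl)

lemma relStable_single (M : CoxeterMatrix B) (X C : Set B) (s : B) (hX : X ⊆ {s}) :
    RelStable M X C := by
  intro a b g ha hb _ hc
  have hz : ∀ a ∈ AP M X, ∃ k : ℤ, a = σ M s ^ k := by
    intro a ha
    have : AP M X ≤ Subgroup.zpowers (σ M s) := by
      rw [AP, Subgroup.closure_le]
      rintro _ ⟨x, hx, rfl⟩
      rw [hX hx]
      exact Subgroup.mem_zpowers _
    obtain ⟨k, hk⟩ := Subgroup.mem_zpowers_iff.1 (this ha)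
    exact ⟨k, hk.symm⟩
  obtain ⟨k, rfl⟩ := hz a ha
  obtain ⟨l, rfl⟩ := hz b hb
  have := congrArg (expo M) hc
  simp only [map_mul, map_inv, map_zpow] at this
  rw [mul_comm, ← mul_assoc, mul_inv_cancel, one_mul] at this
  have hkl : k = l := by
    have h1 : expo M (σ M s) = Multiplicative.ofAdd 1 := artinLift_σ _ _ _ _
    rw [h1, ← ofAdd_zsmul, ← ofAdd_zsmul] at this
    simpa using Multiplicative.ofAdd.injective this
  exact ⟨1, one_mem _, by simp [hkl]⟩

lemma ReachIn.symm' {M : CoxeterMatrix B} {X : Set B} {s t : B} (h : ReachIn M X s t) :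
    ReachIn M X t s := by
  induction h with
  | refl => exact .refl
  | tail _ h ih =>
    refine Relation.ReflTransGen.head ⟨h.2.1, h.1, h.2.2.1.symm, ?_⟩ ih
    rw [M.symmetric]; exact h.2.2.2

lemma f4_stable (M : CoxeterMatrix B) (e : B ≃ Fin 4)
    (he : ∀ a b, M a b = CoxeterMatrix.F₄ (e a) (e b)) (X : Set B)
    (hXd : ¬ ConnectedIn M X) : IsConjugacyStable (AP M X) := by
  have hX : (X ∩ {s | e s < 2}) ∪ (X ∩ {s | ¬ e s < 2}) = X := by
    ext x; simp only [Set.mem_union, Set.mem_inter_iff, Set.mem_ofPred_eq]; tauto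
  rw [← hX]
  apply stable_split M {s | e s < 2}
  · have : ∀ i j : Fin 4, i < 2 → ¬ j < 2 → Even (CoxeterMatrix.F₄ i j) := by
      intro i j; fin_cases i <;> fin_cases j <;> decide
    intro s t hs ht
    rw [he]; exact this _ _ hs ht
  · exact Set.inter_subset_right
  · exact Set.inter_subset_right
  · rintro x ⟨hx, hx2⟩ y ⟨hy, hy2⟩
    by_contra hne
    apply hXd
    have h12 : e x = 1 ∧ e y = 2 := by
      have : ∀ i j : Fin 4, i < 2 → ¬ j < 2 → CoxeterMatrix.F₄ i j ≠ 2 → i = 1 ∧ j = 2 := by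
        intro i j; fin_cases i <;> fin_cases j <;> decide
      exact this _ _ hx2 hy2 (by rwa [← he])
    have adj : ∀ a ∈ X, ∀ b ∈ X, CoxeterMatrix.F₄ (e a) (e b) ≠ 2 → ReachIn M X a b := by
      intro a ha b hb h
      by_cases hab : a = b
      · subst hab; exact .refl
      · exact Relation.ReflTransGen.single ⟨ha, hb, hab, by rwa [he]⟩
    have all : ∀ a ∈ X, ReachIn M X a x := by
      intro a ha
      have h4 : ∀ i : Fin 4, CoxeterMatrix.F₄ i 1 ≠ 2 ∨ CoxeterMatrix.F₄ i 2 ≠ 2 := by decide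
      rcases h4 (e a) with h | h
      · exact adj a ha x hx (by rw [h12.1]; exact h)
      · refine Relation.ReflTransGen.trans (adj a ha y hy (by rw [h12.2]; exact h))
          (adj y hy x hx ?_)
        rw [h12.1, h12.2]; decide
    intro s hs t ht
    exact Relation.ReflTransGen.trans (all s hs) (all t ht).symm'
  · by_cases h : ∃ s, X ∩ {s | e s < 2} ⊆ {s}
    · obtain ⟨s, hs⟩ := h
      exact relStable_single M _ _ s hs
    · have : X ∩ {s | e s < 2} = {s | e s < 2} := by
        apply subset_antisymm Set.inter_subset_right
        intro s hs
        refine ⟨?_, hs⟩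
        by_contra hsX
        apply h
        have h4 : ∀ i : Fin 4, i < 2 → ∃ i', ∀ k < 2, k ≠ i → k = i' := by decide
        obtain ⟨i', hi'⟩ := h4 (e s) hs
        refine ⟨e.symm i', fun t ht => ?_⟩
        rw [Set.mem_singleton_iff, Equiv.eq_symm_apply]
        refine hi' _ ht.2 (fun h => hsX ?_)
        rw [← e.injective h]; exact ht.1
      rw [this]; exact relStable_self M _
  · have hcompl : {s : B | e s < 2}ᶜ = {s | ¬ e s < 2} := rfl
    rw [hcompl]
    by_cases h : ∃ s, X ∩ {s | ¬ e s < 2} ⊆ {s}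
    · obtain ⟨s, hs⟩ := h
      exact relStable_single M _ _ s hs
    · have : X ∩ {s | ¬ e s < 2} = {s | ¬ e s < 2} := by
        apply subset_antisymm Set.inter_subset_right
        intro s hs
        refine ⟨?_, hs⟩
        by_contra hsX
        apply h
        have h4 : ∀ i : Fin 4, ¬ i < 2 → ∃ i', ∀ k, ¬ k < 2 → k ≠ i → k = i' := by decide
        obtain ⟨i', hi'⟩ := h4 (e s) hs
        refine ⟨e.symm i', fun t ht => ?_⟩
        rw [Set.mem_singleton_iff, Equiv.eq_symm_apply]
        refine hi' _ ht.2 (fun h => hsX ?_)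
        rw [← e.injective h]; exact ht.1
      rw [this]; exact relStable_self M _

end
end ArtinTits

namespace ArtinTits
section
variable {B : Type*}

lemma Bmat_apply (n : ℕ) (i j : Fin n) : Bmat n i j =
    if i = j then 1
      else (if (i.val = 0 ∧ j.val = 1) ∨ (j.val = 0 ∧ i.val = 1) then 4
        else (if (j : ℕ) + 1 = i ∨ (i : ℕ) + 1 = j then 3 else 2)) := rfl

lemma altProd_two {G : Type*} [Group G] (x y : G) : altProd x y 2 = x * y := by
  simp [altProd]

lemma altProd_three {G : Type*} [Group G] (x y : G) : altProd x y 3 = x * y * x := by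
  simp [altProd, mul_assoc]

/-- the braid generators inside the Artin group of type B -/
def tauB (M : CoxeterMatrix B) (n : ℕ) (e : B ≃ Fin n) (i : ℕ) : ArtinGroup M :=
  if h : i + 1 < n then σ M (e.symm ⟨i + 1, h⟩) else 1

lemma tauB_eq (M : CoxeterMatrix B) (n : ℕ) (e : B ≃ Fin n) (s : B) (hs : (e s).val ≠ 0) :
    tauB M n e ((e s).val - 1) = σ M s := by
  have h : (e s).val - 1 + 1 = (e s).val := by omega
  have h' : (e s).val - 1 + 1 < n := by have := (e s).isLt; omega
  rw [tauB, dif_pos h']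
  congr 1
  rw [Equiv.symm_apply_eq]
  exact Fin.ext h

variable (M : CoxeterMatrix B) (n : ℕ) (e : B ≃ Fin n)
  (he : ∀ a b : B, M a b = Bmat n (e a) (e b))

include he in
lemma tauB_comm (i j : ℕ) (hij : i + 1 < j) :
    tauB M n e i * tauB M n e j = tauB M n e j * tauB M n e i := by
  by_cases h : j + 1 < n
  · rw [tauB, tauB, dif_pos (by omega), dif_pos h]
    apply (σ_comm M _).eq
    rw [he, Bmat_apply]
    simp only [Equiv.apply_symm_apply, Fin.mk.injEq]
    rw [if_neg (by omega), if_neg (by omega), if_neg (by omega)]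
  · have : tauB M n e j = 1 := by rw [tauB, dif_neg h]
    rw [this]; simp

include he in
lemma tauB_braid (i : ℕ) (hi : i + 1 < n - 1) :
    tauB M n e i * tauB M n e (i+1) * tauB M n e i =
      tauB M n e (i+1) * tauB M n e i * tauB M n e (i+1) := by
  rw [tauB, tauB, dif_pos (by omega), dif_pos (by omega)]
  have := σ_rel M (e.symm ⟨i + 1, by omega⟩) (e.symm ⟨i + 1 + 1, by omega⟩)
  have h3 : M (e.symm ⟨i + 1, by omega⟩) (e.symm ⟨i + 1 + 1, by omega⟩) = 3 := by
    rw [he, Bmat_apply]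
    simp
  rw [h3, altProd_three, altProd_three] at this
  exact this

lemma Pm_rel (τ : ℕ → ArtinGroup M) (N : ℕ)
    (hcomm : ∀ i j, i + 1 < j → τ i * τ j = τ j * τ i)
    (hbraid : ∀ i, i + 1 < N → τ i * τ (i+1) * τ i = τ (i+1) * τ i * τ (i+1))
    (i : ℕ) (hi : i + 1 < N) : Pm τ i * Pm τ (i+1) * Pm τ i = Pm τ (i+1) * Pm τ i * Pm τ (i+1) := by
  apply Pm_braid τ i (hbraid i hi)
  intro h1
  have := hbraid (i-1) (by omega)
  rwa [show i - 1 + 1 = i by omega] at this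

include he in
lemma exists_D : ∃ D : ArtinGroup M →* Equiv.Perm (ℕ × ArtinGroup M),
    ∀ i < n - 1, D (tauB M n e i) = Pm (tauB M n e) i := by
  set τ := tauB M n e with hτ
  let f : B → Equiv.Perm (ℕ × ArtinGroup M) :=
    fun s => if (e s).val = 0 then 1 else Pm τ ((e s).val - 1)
  have hrel : ∀ s t, M s t ≠ 0 → altProd (f s) (f t) (M s t) = altProd (f t) (f s) (M s t) := by
    have half : ∀ s t, (e s).val ≤ (e t).val →
        altProd (f s) (f t) (M s t) = altProd (f t) (f s) (M s t) := by
      intro s t hst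
      have h1 := (e t).isLt
      rcases eq_or_lt_of_le hst with heq | hlt
      · have : s = t := e.injective (Fin.ext heq)
        rw [this]
      have hne : e s ≠ e t := fun h => by rw [h] at hlt; omega
      rw [he, Bmat_apply, if_neg hne]
      by_cases h0 : (e s).val = 0
      · have hf : f s = 1 := by simp [f, h0]
        rw [hf]
        have : ∀ k : ℕ, altProd 1 (f t) (2 * k) = altProd (f t) 1 (2 * k) := fun k => by
          rw [(altProd_one_left _ k).1, (altProd_one_left _ k).2]
        split_ifs
        · exact this 2
        · omega
        · exact this 1
      · have hfs : f s = Pm τ ((e s).val - 1) := by simp [f, h0]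
        have hft : f t = Pm τ ((e t).val - 1) := by
          have : (e t).val ≠ 0 := by omega
          simp only [f, if_neg this]
        rw [hfs, hft, if_neg (by omega)]
        split_ifs with h
        · rw [altProd_three, altProd_three, show (e t).val - 1 = ((e s).val - 1) + 1 by omega]
          exact Pm_rel M τ (n-1) (tauB_comm M n e he) (tauB_braid M n e he) _ (by omega)
        · rw [altProd_two, altProd_two]
          exact Pm_comm τ (by omega) (tauB_comm M n e he)
    intro s t _
    rcases le_total (e s).val (e t).val with h | h
    · exact half s t h
    · rw [M.symmetric s t]; exact (half t s h).symm
  refine ⟨artinLift M f hrel, fun i hi => ?_⟩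
  have : τ i = σ M (e.symm ⟨i + 1, by omega⟩) := by rw [hτ, tauB, dif_pos (by omega)]
  rw [this, artinLift_σ]
  simp [f]

include he in
lemma Bn_Adj {a b : B} (hab : Adj M a b) :
    (e b).val + 1 = (e a).val ∨ (e a).val + 1 = (e b).val := by
  have h := hab.2
  rw [he, Bmat_apply] at h
  have hne : e a ≠ e b := fun h => hab.1 (e.injective h)
  rw [if_neg hne] at h
  split_ifs at h <;> omega

include he in
lemma bn_stable (pn : 0 < n) (hn : 3 ≤ n) (Z : Set B) (hZne : Z.Nonempty)
    (hZ : ∀ z ∈ Z, 2 ≤ (e z).val) (hZc : ConnectedIn M Z) :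
    IsConjugacyStable (AP M (insert (e.symm ⟨0, pn⟩) Z)) := by
  rw [Set.insert_eq]
  set a : B := e.symm ⟨0, pn⟩ with hadef
  have ha : (e a).val = 0 := by simp [hadef]
  have ha' : ∀ t, t ≠ a → (e t).val ≠ 0 := by
    intro t ht h
    exact ht (e.injective (Fin.ext (by rw [h, ha])))
  apply stable_split M {a}
  · rintro s t rfl ht
    have ht0 := ha' t ht
    rw [he, Bmat_apply, if_neg (fun h => ht0 (by rw [← h, ha]))]
    split_ifs
    · decide
    · omega
    · decide
  · exact subset_rfl
  · rintro z hz rfl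
    have := hZ _ hz
    omega
  · rintro x rfl y hy
    have := hZ y hy
    rw [he, Bmat_apply, if_neg (fun h => by rw [← h, ha] at this; omega), if_neg (by omega),
      if_neg (by omega)]
  · exact relStable_self M _
  · -- the interval
    classical
    let T : Set ℕ := {i | ∃ z ∈ Z, (e z).val = i}
    have hTne : ∃ i, i ∈ T := by
      obtain ⟨z, hz⟩ := hZne
      exact ⟨_, z, hz, rfl⟩
    let p := Nat.find hTne
    obtain ⟨zp, hzp, hzpe⟩ : p ∈ T := Nat.find_spec hTne
    have hpmin : ∀ z ∈ Z, p ≤ (e z).val := fun z hz => Nat.find_min' hTne ⟨z, hz, rfl⟩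
    have hp2 : 2 ≤ p := by rw [← hzpe]; exact hZ _ hzp
    -- downward closed to p
    have hdown : ∀ z ∈ Z, ∀ i, p ≤ i → i ≤ (e z).val → i ∈ T := by
      intro z hz
      have hr := hZc zp hzp z hz
      have : ∀ y, ReachIn M Z zp y → y ∈ Z → ∀ i, p ≤ i → i ≤ (e y).val → i ∈ T := by
        intro y hy
        induction hy with
        | refl => 
          intro _ i h1 h2
          exact ⟨zp, hzp, by omega⟩
        | @tail b c hb hbc ih =>
          intro hc i h1 h2
          rcases eq_or_lt_of_le h2 with h | h
          · exact ⟨c, hc, h.symm⟩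
          · have := Bn_Adj M n e he hbc.2.2
            exact ih hbc.1 i h1 (by omega)
      exact this z hr hz
    obtain ⟨q, hq1, hq2⟩ : ∃ q, q ∈ T ∧ ∀ i ∈ T, i ≤ q := by
      have hb : BddAbove T := ⟨n, by rintro _ ⟨z, _, rfl⟩; exact (e z).isLt.le⟩
      exact ⟨sSup T, Nat.sSup_mem hTne hb, fun i hi => le_csSup hb hi⟩
    have hqn : q < n := by obtain ⟨z, _, rfl⟩ := hq1; exact (e z).isLt
    have hpq : p ≤ q := hq2 p ⟨zp, hzp, hzpe⟩
    have hZint : ∀ z, z ∈ Z ↔ p ≤ (e z).val ∧ (e z).val ≤ q := by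
      intro z
      constructor
      · intro hz; exact ⟨hpmin z hz, hq2 _ ⟨z, hz, rfl⟩⟩
      · rintro ⟨h1, h2⟩
        obtain ⟨zq, hzq, hzqe⟩ := hq1
        obtain ⟨z', hz', h3⟩ := hdown zq hzq _ h1 (by omega)
        rwa [← e.injective (Fin.ext h3)]
    obtain ⟨D, hD⟩ := exists_D M n e he
    have hAPZ : AP M Z = Subgroup.closure (tauB M n e '' {i | p - 1 ≤ i ∧ i < p - 1 + (q - p + 1)}) := by
      rw [AP]
      congr 1
      ext x
      constructor
      · rintro ⟨z, hz, rfl⟩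
        have := (hZint z).1 hz
        refine ⟨(e z).val - 1, by simp only [Set.mem_ofPred_eq]; omega, ?_⟩
        exact tauB_eq M n e z (by omega)
      · rintro ⟨i, hi, rfl⟩
        simp only [Set.mem_ofPred_eq] at hi
        have hin : i + 1 < n := by omega
        refine ⟨e.symm ⟨i + 1, hin⟩, (hZint _).2 ?_, ?_⟩
        · simp only [Equiv.apply_symm_apply]; omega
        · rw [tauB, dif_pos hin]
    have hAPC : AP M {a}ᶜ ≤ Br (tauB M n e) (n - 1 + 1) := by
      rw [AP, Subgroup.closure_le]
      rintro _ ⟨s, hs, rfl⟩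
      have h0 := ha' s hs
      rw [← tauB_eq M n e s h0]
      exact mem_Br _ (by have := (e s).isLt; omega)
    intro x y g hx hy hg hc
    rw [hAPZ] at hx hy ⊢
    exact interval_stable (tauB M n e) (n-1) D hD (tauB_comm M n e he) (tauB_braid M n e he)
      _ _ (by omega) x y g hx hy (hAPC hg) hc

end
end ArtinTits

namespace ArtinTits
section
variable {B : Type*}

lemma kf_le_of_le (M : CoxeterMatrix B) (s t : B) (k : ℕ) (hk : 1 ≤ k)
    (h : M s t = 0 ∨ k ≤ M s t) : kf M s t ≤ -(2 * Real.cos (Real.pi / k)) := by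
  have hkR : (1:ℝ) ≤ k := by exact_mod_cast hk
  have hpi := Real.pi_pos
  unfold kf
  have : Real.cos (Real.pi / k) ≤ Real.cos (Real.pi / (M s t : ℝ)) := by
    apply Real.cos_le_cos_of_nonneg_of_le_pi
    · positivity
    · exact div_le_self hpi.le hkR
    · rcases h with h | h
      · rw [h]; simp; positivity
      · have : (k:ℝ) ≤ (M s t : ℝ) := by exact_mod_cast h
        gcongr
  linarith

lemma M_ne_one (M : CoxeterMatrix B) {s t : B} (h : s ≠ t) : M s t ≠ 1 := M.off_diagonal s t h

lemma kf_nonpos (M : CoxeterMatrix B) {s t : B} (h : s ≠ t) : kf M s t ≤ 0 := by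
  have h1 := M_ne_one M h
  have := kf_le_of_le M s t 2 (by norm_num) (by omega)
  simpa using this

lemma kf_le_one (M : CoxeterMatrix B) {s t : B} (h : Adj M s t) : kf M s t ≤ -1 := by
  have h1 := M_ne_one M h.1
  have h2 := h.2
  have := kf_le_of_le M s t 3 (by norm_num) (by omega)
  simpa using this

lemma kf_three (M : CoxeterMatrix B) {s t : B} (h : M s t = 3) : kf M s t = -1 := by
  unfold kf; rw [h]; simp

lemma kf_four (M : CoxeterMatrix B) {s t : B} (h : M s t = 4) : kf M s t = -√2 := by
  unfold kf; rw [h]; simp; ring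

lemma kf_le_sqrt2 (M : CoxeterMatrix B) {s t : B} (h : Adj M s t) (h3 : M s t ≠ 3) :
    kf M s t ≤ -√2 := by
  have h1 := M_ne_one M h.1
  have h2 := h.2
  have := kf_le_of_le M s t 4 (by norm_num) (by omega)
  simp at this
  linarith

lemma kf_le_sqrt3 (M : CoxeterMatrix B) {s t : B} (h : M s t = 0 ∨ 6 ≤ M s t) :
    kf M s t ≤ -√3 := by
  have := kf_le_of_le M s t 6 (by norm_num) h
  simp at this
  linarith

lemma Adj.symm' {M : CoxeterMatrix B} {s t : B} (h : Adj M s t) : Adj M t s :=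
  ⟨h.1.symm, by rw [M.symmetric]; exact h.2⟩

lemma not_adj {M : CoxeterMatrix B} {s t : B} (hne : s ≠ t) (h : ¬ Adj M s t) : M s t = 2 := by
  by_contra h2; exact h ⟨hne, h2⟩

/-- abstract positive definite form -/
structure PD (M : CoxeterMatrix B) (E : Type*) [AddCommGroup E] [Module ℝ E] where
  f : LinearMap.BilinForm ℝ E
  b : B → E
  co : B → E →ₗ[ℝ] ℝ
  fb : ∀ s t, f (b s) (b t) = kf M s t
  fsymm : ∀ x y, f x y = f y x
  cob : ∀ s, co s (b s) = 1
  cob' : ∀ s t, s ≠ t → co s (b t) = 0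
  pos : ∀ x, x ≠ 0 → 0 < f x x

open Classical in
lemma exists_PD [Finite B] (M : CoxeterMatrix B) [Finite M.Group]
    (hconn : ConnectedIn M Set.univ) : Nonempty (PD M (B → ℝ)) := by
  have := Fintype.ofFinite B
  have key : ∀ x y : B → ℝ, Matrix.toBilin' (Matrix.of (kf M)) x y =
      ∑ s, x s * ∑ t, kf M s t * y t := by
    intro x y
    rw [Matrix.toBilin'_apply]
    refine Finset.sum_congr rfl fun s _ => ?_
    rw [Finset.mul_sum]
    refine Finset.sum_congr rfl fun t _ => ?_
    simp [mul_assoc]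
  refine ⟨⟨Matrix.toBilin' (Matrix.of (kf M)), fun s => Pi.single s 1, fun s => LinearMap.proj s,
    ?_, ?_, ?_, ?_, ?_⟩⟩
  · intro s t
    rw [Matrix.toBilin'_single]; rfl
  · intro x y
    rw [key, key]
    simp only [Finset.mul_sum]
    rw [Finset.sum_comm]
    refine Finset.sum_congr rfl fun s _ => Finset.sum_congr rfl fun t _ => ?_
    rw [kf_symm M s t]; ring
  · intro s; simp
  · intro s t h; simp [h]
  · intro x hx
    rw [key]; exact posdef M hconn x hx

namespace PD
variable {M : CoxeterMatrix B} {E : Type*} [AddCommGroup E] [Module ℝ E] (P : PD M E)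
include P

lemma pos_of_co (x : E) (s : B) (h : P.co s x ≠ 0) : 0 < P.f x x := by
  apply P.pos
  rintro rfl
  simp at h

lemma three (a p u : B) (hap : a ≠ p) (hau : a ≠ u) (hpu : p ≠ u) (x y z : ℝ) (hx : x ≠ 0) :
    0 < 2 * (x^2 + y^2 + z^2) + 2 * (kf M a p * (x * y) + kf M p u * (y * z)
      + kf M a u * (x * z)) := by
  have := P.pos_of_co (x • P.b a + y • P.b p + z • P.b u) a
    (by simp [P.cob, P.cob' a p hap, P.cob' a u hau, hx])
  simp only [map_add, map_smul, LinearMap.add_apply, LinearMap.smul_apply, P.fb, kf_self,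
    smul_eq_mul, kf_symm M p a, kf_symm M u a, kf_symm M u p] at this
  linarith

lemma four (a p u w : B) (hap : a ≠ p) (hau : a ≠ u) (haw : a ≠ w)
    (x y z t : ℝ) (hx : x ≠ 0) :
    0 < 2 * (x^2 + y^2 + z^2 + t^2) + 2 * (kf M a p * (x * y) + kf M p u * (y * z)
      + kf M a u * (x * z) + kf M a w * (x * t) + kf M p w * (y * t) + kf M u w * (z * t)) := by
  have := P.pos_of_co (x • P.b a + y • P.b p + z • P.b u + t • P.b w) a
    (by simp [P.cob, P.cob' a p hap, P.cob' a u hau, P.cob' a w haw, hx])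
  simp only [map_add, map_smul, LinearMap.add_apply, LinearMap.smul_apply, P.fb, kf_self,
    smul_eq_mul, kf_symm M p a, kf_symm M u a, kf_symm M u p,
    kf_symm M w a, kf_symm M w p, kf_symm M w u] at this
  linarith

lemma five (a p u w v : B) (hap : a ≠ p) (hau : a ≠ u) (haw : a ≠ w) (hav : a ≠ v)
    (x y z t r : ℝ) (hx : x ≠ 0) :
    0 < 2 * (x^2 + y^2 + z^2 + t^2 + r^2) + 2 * (kf M a p * (x * y) + kf M p u * (y * z)
      + kf M a u * (x * z) + kf M a w * (x * t) + kf M p w * (y * t) + kf M u w * (z * t)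
      + kf M a v * (x * r) + kf M p v * (y * r) + kf M u v * (z * r) + kf M w v * (t * r)) := by
  have := P.pos_of_co (x • P.b a + y • P.b p + z • P.b u + t • P.b w + r • P.b v) a
    (by simp [P.cob, P.cob' a p hap, P.cob' a u hau, P.cob' a w haw, P.cob' a v hav, hx])
  simp only [map_add, map_smul, LinearMap.add_apply, LinearMap.smul_apply, P.fb, kf_self,
    smul_eq_mul, kf_symm M p a, kf_symm M u a, kf_symm M u p,
    kf_symm M w a, kf_symm M w p, kf_symm M w u,
    kf_symm M v a, kf_symm M v p, kf_symm M v u, kf_symm M v w] at this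
  linarith

/-- no label at least six next to another edge -/
lemma no_six {q p u : B} (hqp : q ≠ p) (h6 : M q p = 0 ∨ 6 ≤ M q p) (hu : Adj M p u)
    (huq : q ≠ u) : False := by
  have h := P.three q p u hqp huq hu.1 (√3) 2 1 (by positivity)
  have h1 := kf_le_sqrt3 M h6
  have h2 := kf_le_one M hu
  have h3 := kf_nonpos M huq
  have s3 : √3 * √3 = 3 := Real.mul_self_sqrt (by norm_num)
  have hp : 0 < √3 := by positivity
  nlinarith [mul_le_mul_of_nonneg_right h1 hp.le, mul_nonneg (neg_nonneg.2 h3) hp.le]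

/-- the neighbouring label is three -/
lemma label_three {q p u : B} (hqp : q ≠ p) (h4 : M q p = 4) (hu : Adj M p u)
    (huq : q ≠ u) : M p u = 3 := by
  by_contra hne
  have h := P.three q p u hqp huq hu.1 1 (√2) 1 (by norm_num)
  have h1 := kf_four M h4
  have h2 := kf_le_sqrt2 M hu hne
  have h3 := kf_nonpos M huq
  have s3 : √2 * √2 = 2 := Real.mul_self_sqrt (by norm_num)
  have hp : 0 < √2 := by positivity
  rw [h1] at h
  nlinarith [mul_le_mul_of_nonneg_right h2 hp.le]

/-- no fork at the end of the edge with label four -/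
lemma fork_four {q p u u' : B} (hqp : q ≠ p) (h4 : M q p = 4) (hu : Adj M p u) (hu' : Adj M p u')
    (huq : q ≠ u) (huq' : q ≠ u') : u = u' := by
  by_contra hne
  have h := P.four q p u u' hqp huq huq' (√2) 2 1 1 (by positivity)
  have h1 := kf_four M h4
  have h2 := kf_le_one M hu
  have h2' := kf_le_one M hu'
  have h3 := kf_nonpos M huq
  have h3' := kf_nonpos M huq'
  have h5 := kf_nonpos M hne
  have s3 : √2 * √2 = 2 := Real.mul_self_sqrt (by norm_num)
  have hp : 0 < √2 := by positivity
  rw [h1] at h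
  nlinarith [mul_nonneg (neg_nonneg.2 h3) hp.le, mul_nonneg (neg_nonneg.2 h3') hp.le]

lemma triangle {q p u : B} (hqp : q ≠ p) (h4 : M q p = 4) (hu : Adj M p u) (hqu : Adj M q u) :
    False := by
  have h := P.three q p u hqp hqu.1 hu.1 1 1 1 (by norm_num)
  have h1 := kf_four M h4
  have h2 := kf_le_one M hu
  have h3 := kf_le_one M hqu
  have hp : 1 < √2 := by rw [Real.lt_sqrt] <;> norm_num
  linarith

lemma square {r q p u : B} (hqp : q ≠ p) (h4 : M q p = 4) (hrq : Adj M r q) (hpu : Adj M p u)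
    (hrp : r ≠ p) (hqu : q ≠ u) (hru : Adj M r u) : False := by
  have h := P.four r q p u hrq.1 hrp hru.1 1 1 1 1 (by norm_num)
  have h1 := kf_four M h4
  have h2 := kf_le_one M hrq
  have h3 := kf_le_one M hpu
  have h4 := kf_le_one M hru
  have h5 := kf_nonpos M hrp
  have h6 := kf_nonpos M hqu
  have hp : 1 < √2 := by rw [Real.lt_sqrt] <;> norm_num
  linarith

lemma ftilde {r q p u w : B} (hqp : q ≠ p) (h4 : M q p = 4) (hrq : Adj M r q) (hpu : Adj M p u)
    (huw : Adj M u w) (hrp : r ≠ p) (hru : r ≠ u) (hqu : q ≠ u)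
    (hwr : w ≠ r) (hwq : w ≠ q) (hwp : w ≠ p) : False := by
  have h := P.five w u p q r huw.symm'.1 hwp hwq hwr 1 2 3 (2 * √2) (√2) (by norm_num)
  have h1 := kf_four M h4
  rw [kf_symm M p q, h1, kf_symm M w u, kf_symm M u p, kf_symm M q r] at h
  have h2 := kf_le_one M hrq
  have h3 := kf_le_one M hpu
  have h3' := kf_le_one M huw
  have h5 := kf_nonpos M hwp
  have h6 := kf_nonpos M hwq
  have h7 := kf_nonpos M hwr
  have h8 := kf_nonpos M hqu.symm
  have h9 := kf_nonpos M hru.symm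
  have h10 := kf_nonpos M hrp.symm
  have s3 : √2 * √2 = 2 := Real.mul_self_sqrt (by norm_num)
  have hp : 0 < √2 := by positivity
  nlinarith [mul_nonneg (neg_nonneg.2 h6) hp.le, mul_nonneg (neg_nonneg.2 h7) hp.le,
    mul_nonneg (neg_nonneg.2 h8) hp.le, mul_nonneg (neg_nonneg.2 h9) hp.le,
    mul_nonneg (neg_nonneg.2 h10) hp.le]

end PD
end
end ArtinTits

namespace ArtinTits
section
variable {B : Type*}

lemma closed_univ {M : CoxeterMatrix B} (hconn : ConnectedIn M Set.univ) (T : Set B) {a : B}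
    (ha : a ∈ T) (hT : ∀ x ∈ T, ∀ y, Adj M x y → y ∈ T) (b : B) : b ∈ T := by
  have h := hconn a trivial b trivial
  induction h with
  | refl => exact ha
  | tail _ h ih => exact hT _ ih _ h.2.2

lemma closed_univ_not {M : CoxeterMatrix B} (hconn : ConnectedIn M Set.univ) (T : Set B) {a w : B}
    (ha : a ∈ T) (hw : w ∉ T) : ∃ x ∈ T, ∃ y, y ∉ T ∧ Adj M x y := by
  by_contra! h
  exact hw (closed_univ hconn T ha (fun x hx y hxy => by
    by_contra hy; exact h x hx y hy hxy) w)

lemma f4_type {M : CoxeterMatrix B} {E : Type*} [AddCommGroup E] [Module ℝ E] (P : PD M E)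
    (hconn : ConnectedIn M Set.univ) {r q p u : B} (hqp : q ≠ p) (h4 : M q p = 4)
    (hqr : Adj M q r) (hrp : r ≠ p) (hpu : Adj M p u) (huq : u ≠ q) :
    IsOfType M Set.univ CoxeterMatrix.F₄ := by
  have h4' : M p q = 4 := by rw [M.symmetric]; exact h4
  have hpu3 : M p u = 3 := P.label_three hqp h4 hpu huq.symm
  have hqr3 : M q r = 3 := P.label_three hqp.symm h4' hqr hrp.symm
  have hru : r ≠ u := by
    rintro rfl
    exact P.triangle hqp h4 hpu hqr
  have hnru : ¬ Adj M r u := fun h => P.square hqp h4 hqr.symm' hpu hrp huq.symm h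
  have hnqu : ¬ Adj M q u := fun h => P.triangle hqp h4 hpu h
  have hnpr : ¬ Adj M p r := fun h => P.triangle hqp h4 h hqr
  have mem : ∀ b : B, b ∈ ({r, q, p, u} : Set B) := by
    refine closed_univ hconn {r, q, p, u} (a := q) (by simp) ?_
    intro x hx y hxy
    by_contra hy
    simp only [Set.mem_insert_iff, Set.mem_singleton_iff, not_or] at hx hy
    obtain ⟨hyr, hyq, hyp, hyu⟩ := hy
    rcases hx with rfl | rfl | rfl | rfl
    · exact P.ftilde hqp.symm h4' hpu.symm' hqr hxy huq hru.symm hrp.symm hyu hyp hyq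
    · exact hyr (P.fork_four hqp.symm h4' hxy hqr (Ne.symm hyp) hrp.symm)
    · exact hyu (P.fork_four hqp h4 hxy hpu (Ne.symm hyq) huq.symm)
    · exact P.ftilde hqp h4 hqr.symm' hpu hxy hrp hru huq.symm hyr hyq hyp
  have hru2 := not_adj hru hnru
  have hqu2 := not_adj huq.symm hnqu
  have hpr2 := not_adj hrp.symm hnpr
  let g : Fin 4 → B := ![r, q, p, u]
  have hg : Function.Bijective g := by
    constructor
    · intro i j hij
      have hrq := hqr.1
      have hpu' := hpu.1
      fin_cases i <;> fin_cases j <;> simp [g] at hij ⊢ <;> simp_all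
    · intro b
      rcases mem b with h | h | h | h
      · exact ⟨0, h.symm⟩
      · exact ⟨1, h.symm⟩
      · exact ⟨2, h.symm⟩
      · exact ⟨3, h.symm⟩
  refine ⟨(Equiv.Set.univ B).trans (Equiv.ofBijective g hg).symm, ?_⟩
  have key : ∀ i j, M (g i) (g j) = CoxeterMatrix.F₄ i j := by
    intro i j
    have e1 : M r q = 3 := by rw [M.symmetric]; exact hqr3
    have e2 : M u p = 3 := by rw [M.symmetric]; exact hpu3
    have e3 : M u r = 2 := by rw [M.symmetric]; exact hru2
    have e4 : M u q = 2 := by rw [M.symmetric]; exact hqu2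
    have e5 : M r p = 2 := by rw [M.symmetric]; exact hpr2
    fin_cases i <;> fin_cases j <;>
      simp [g, CoxeterMatrix.F₄, h4, h4', hpu3, hqr3, hru2, hqu2, hpr2, e1, e2, e3, e4, e5]
  intro a b
  rw [← key]
  congr 1
  · exact ((Equiv.ofBijective g hg).apply_symm_apply a.val).symm
  · exact ((Equiv.ofBijective g hg).apply_symm_apply b.val).symm

/-- partial chain of type B -/
structure Chain {M : CoxeterMatrix B} {E : Type*} [AddCommGroup E] [Module ℝ E] (P : PD M E)
    (q p : B) (k : ℕ) where
  v : ℕ → B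
  y : E
  v0 : v 0 = q
  v1 : v 1 = p
  inj : ∀ i j, i < j → j ≤ k → v i ≠ v j
  lab : ∀ i j, i < j → j ≤ k → M (v i) (v j) =
    if i = 0 ∧ j = 1 then 4 else if i + 1 = j then 3 else 2
  closed : ∀ i < k, ∀ u, Adj M (v i) u → ∃ j ≤ k, u = v j
  yy : P.f y y = 2
  yu : ∀ u, (∀ j ≤ k, u ≠ v j) → P.f y (P.b u) = √2 * kf M (v k) u
  yc : ∀ u, (∀ j ≤ k, u ≠ v j) → P.co u y = 0

lemma chain_one {M : CoxeterMatrix B} {E : Type*} [AddCommGroup E] [Module ℝ E] (P : PD M E)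
    {q p : B} (hqp : q ≠ p) (h4 : M q p = 4) (hleaf : ∀ u, Adj M q u → u = p) :
    Nonempty (Chain P q p 1) := by
  have s3 : √2 * √2 = 2 := Real.mul_self_sqrt (by norm_num)
  refine ⟨⟨fun i => if i = 0 then q else p, P.b q + √2 • P.b p, by simp, by simp, ?_, ?_, ?_, ?_,
    ?_, ?_⟩⟩
  · intro i j hij hj
    obtain rfl : i = 0 := by omega
    obtain rfl : j = 1 := by omega
    simpa using hqp
  · intro i j hij hj
    obtain rfl : i = 0 := by omega
    obtain rfl : j = 1 := by omega
    simpa using h4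
  · intro i hi u hu
    obtain rfl : i = 0 := by omega
    exact ⟨1, le_rfl, by simpa using hleaf u (by simpa using hu)⟩
  · simp only [map_add, map_smul, LinearMap.add_apply, LinearMap.smul_apply, P.fb, kf_self,
      smul_eq_mul, kf_symm M p q, kf_four M h4]
    linarith
  · intro u hu
    have h0 := hu 0 (by norm_num)
    have h1 := hu 1 (by norm_num)
    simp at h0 h1
    have h2 : M q u = 2 := not_adj (Ne.symm h0) (fun h => h1 (hleaf u h))
    simp [P.fb, kf_two M h2]
  · intro u hu
    have h0 := hu 0 (by norm_num)
    have h1 := hu 1 (by norm_num)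
    simp at h0 h1
    simp [P.cob' u _ h0, P.cob' u _ h1]

lemma chain_succ {M : CoxeterMatrix B} {E : Type*} [AddCommGroup E] [Module ℝ E] (P : PD M E)
    {q p : B} {k : ℕ} (hk : 1 ≤ k) (C : Chain P q p k) (u : B) (hu : ∀ j ≤ k, u ≠ C.v j)
    (hadj : Adj M (C.v k) u) : Nonempty (Chain P q p (k+1)) := by
  have s3 : √2 * √2 = 2 := Real.mul_self_sqrt (by norm_num)
  have hp : 0 < √2 := by positivity
  have h3 : M (C.v k) u = 3 := by
    by_contra h3
    have h := P.pos_of_co (C.y + P.b u) u (by simp [P.cob, C.yc u hu])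
    simp only [map_add, LinearMap.add_apply, P.fb, kf_self, C.yy, P.fsymm (P.b u) C.y,
      C.yu u hu] at h
    have := kf_le_sqrt2 M hadj h3
    nlinarith [mul_le_mul_of_nonneg_left this hp.le]
  have huniq : ∀ w, (∀ j ≤ k, w ≠ C.v j) → Adj M (C.v k) w → w = u := by
    intro w hw hadjw
    by_contra hne
    have h := P.pos_of_co (√2 • C.y + P.b u + P.b w) u
      (by simp [P.cob, C.yc u hu, P.cob' u w (Ne.symm hne)])
    simp only [map_add, map_smul, LinearMap.add_apply, LinearMap.smul_apply, smul_eq_mul,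
      P.fb, kf_self, C.yy, P.fsymm (P.b u) C.y,
      C.yu u hu, P.fsymm (P.b w) C.y, C.yu w hw, kf_symm M u w] at h
    have h1 := kf_nonpos M hne
    have h2 := kf_le_one M hadj
    have h4 := kf_le_one M hadjw
    have e : ∀ z : ℝ, √2 * (√2 * z) = 2 * z := fun z => by rw [← mul_assoc, s3]
    simp only [mul_add, e] at h
    linarith
  have hnot : ∀ i < k, M (C.v i) u = 2 := by
    intro i hi
    refine not_adj (hu i hi.le).symm fun h => ?_
    obtain ⟨j, hj, rfl⟩ := C.closed i hi u h
    exact hu j hj rfl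
  have hne : ∀ i ≤ k, i ≠ k + 1 := by intros; omega
  have hv : ∀ i ≤ k, Function.update C.v (k+1) u i = C.v i := by
    intro i hi
    exact Function.update_of_ne (hne i hi) _ _
  have hv' : Function.update C.v (k+1) u (k+1) = u := Function.update_self _ _ _
  refine ⟨⟨Function.update C.v (k+1) u, C.y + √2 • P.b u, ?_, ?_, ?_, ?_, ?_, ?_, ?_, ?_⟩⟩
  · rw [hv 0 (by omega), C.v0]
  · rw [hv 1 (by omega), C.v1]
  · intro i j hij hj
    rw [hv i (by omega)]
    rcases Nat.lt_or_ge k j with h | h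
    · obtain rfl : j = k + 1 := by omega
      rw [hv']; exact (hu i (by omega)).symm
    · rw [hv j h]; exact C.inj i j hij h
  · intro i j hij hj
    rw [hv i (by omega)]
    rcases Nat.lt_or_ge k j with h | h
    · obtain rfl : j = k + 1 := by omega
      rw [hv', if_neg (by omega)]
      split_ifs with h'
      · obtain rfl : i = k := by omega
        exact h3
      · exact hnot i (by omega)
    · rw [hv j h]; exact C.lab i j hij h
  · intro i hi w hw
    rw [hv i (by omega)] at hw
    by_cases hin : ∃ j ≤ k, w = C.v j
    · obtain ⟨j, hj, rfl⟩ := hin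
      exact ⟨j, by omega, (hv j hj).symm⟩
    · rcases Nat.lt_or_ge i k with h | h
      · exact absurd (C.closed i h w hw) hin
      · obtain rfl : i = k := by omega
        push Not at hin
        exact ⟨i + 1, le_rfl, by rw [hv']; exact huniq w hin hw⟩
  · simp only [map_add, map_smul, LinearMap.add_apply, LinearMap.smul_apply, smul_eq_mul,
      P.fb, kf_self, C.yy, P.fsymm (P.b u) C.y, C.yu u hu, kf_three M h3]
    linarith
  · intro w hw
    have hwk : ∀ j ≤ k, w ≠ C.v j := fun j hj => by
      have := hw j (by omega); rwa [hv j hj] at this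
    have hwu : w ≠ u := by have := hw (k+1) le_rfl; rwa [hv'] at this
    have h2 : M (C.v k) w = 2 := not_adj (hwk k le_rfl).symm fun h => hwu (huniq w hwk h)
    rw [hv']
    simp [P.fb, C.yu w hwk, kf_two M h2]
  · intro w hw
    have hwk : ∀ j ≤ k, w ≠ C.v j := fun j hj => by
      have := hw j (by omega); rwa [hv j hj] at this
    have hwu : w ≠ u := by have := hw (k+1) le_rfl; rwa [hv'] at this
    simp [C.yc w hwk, P.cob' w u hwu]

lemma bn_type [Finite B] {M : CoxeterMatrix B} {E : Type*} [AddCommGroup E] [Module ℝ E]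
    (P : PD M E)
    (hconn : ConnectedIn M Set.univ) {q p : B} (hqp : q ≠ p) (h4 : M q p = 4)
    (hleaf : ∀ u, Adj M q u → u = p) (hthird : ∃ w, w ≠ q ∧ w ≠ p) :
    ∃ n : ℕ, 3 ≤ n ∧ ∃ e : B ≃ Fin n, ∀ a b : B, M a b = Bmat n (e a) (e b) := by
  have hex : ∃ k, 1 ≤ k ∧ ∃ C : Chain P q p k, ∀ u, Adj M (C.v k) u → ∃ j ≤ k, u = C.v j := by
    by_contra! hno
    have all : ∀ k, 1 ≤ k → Nonempty (Chain P q p k) := by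
      intro k hk
      induction k, hk using Nat.le_induction with
      | base => exact chain_one P hqp h4 hleaf
      | succ k hk ih =>
        obtain ⟨C⟩ := ih
        obtain ⟨u, hu, hu'⟩ := hno k hk C
        exact chain_succ P hk C u hu' hu
    obtain ⟨C⟩ := all (Nat.card B + 1) (by omega)
    have hi : Function.Injective (fun i : Fin (Nat.card B + 1) => C.v i) := by
      intro i j hij
      by_contra hne
      rcases lt_or_gt_of_ne hne with h | h
      · exact C.inj i j h (by omega) hij
      · exact C.inj j i h (by omega) hij.symm
    have := Nat.card_le_card_of_injective _ hi
    simp at this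
  obtain ⟨k, hk, C, hC⟩ := hex
  have mem : ∀ b, ∃ j ≤ k, b = C.v j := by
    intro b
    refine closed_univ hconn {b | ∃ j ≤ k, b = C.v j} (a := C.v 0) ⟨0, by omega, rfl⟩ ?_ b
    rintro x ⟨j, hj, rfl⟩ y hy
    rcases Nat.lt_or_ge j k with h | h
    · exact C.closed j h y hy
    · obtain rfl : j = k := by omega
      exact hC y hy
  have hk2 : 2 ≤ k := by
    by_contra hlt
    obtain rfl : k = 1 := by omega
    obtain ⟨w, hwq, hwp⟩ := hthird
    obtain ⟨j, hj, rfl⟩ := mem w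
    interval_cases j
    · exact hwq C.v0
    · exact hwp C.v1
  let g : Fin (k+1) → B := fun i => C.v i
  have hg : Function.Bijective g := by
    constructor
    · intro i j hij
      by_contra hne
      rcases lt_or_gt_of_ne hne with h | h
      · exact C.inj i j h (by omega) hij
      · exact C.inj j i h (by omega) hij.symm
    · intro b
      obtain ⟨j, hj, rfl⟩ := mem b
      exact ⟨⟨j, by omega⟩, rfl⟩
  refine ⟨k + 1, by omega, (Equiv.ofBijective g hg).symm, ?_⟩
  have half : ∀ i j : Fin (k+1), i < j → M (g i) (g j) = Bmat (k+1) i j := by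
    intro i j hij
    have hij' : i.val < j.val := hij
    rw [Bmat_apply, if_neg hij.ne, C.lab i j hij (by omega)]
    split_ifs <;> first | rfl | omega
  have key : ∀ i j : Fin (k+1), M (g i) (g j) = Bmat (k+1) i j := by
    intro i j
    rcases lt_trichotomy i j with h | h | h
    · exact half i j h
    · subst h; rw [M.diagonal, (Bmat (k+1)).diagonal]
    · rw [M.symmetric, (Bmat (k+1)).symmetric]; exact half j i h
  intro a b
  rw [← key]
  congr 1
  · exact ((Equiv.ofBijective g hg).apply_symm_apply a).symm
  · exact ((Equiv.ofBijective g hg).apply_symm_apply b).symm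

lemma bn_odd {M : CoxeterMatrix B} {n : ℕ} (e : B ≃ Fin n)
    (he : ∀ a b : B, M a b = Bmat n (e a) (e b)) (hn : 3 ≤ n) (j : ℕ) (hj : 1 ≤ j) (hjn : j < n) :
    Relation.ReflTransGen (OddAdj M) (e.symm ⟨1, by omega⟩) (e.symm ⟨j, hjn⟩) := by
  induction j, hj using Nat.le_induction with
  | base => exact .refl
  | succ j hj ih =>
    refine (ih (by omega)).tail ?_
    have : M (e.symm ⟨j, by omega⟩) (e.symm ⟨j + 1, hjn⟩) = 3 := by
      rw [he, Bmat_apply]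
      simp
      omega
    unfold OddAdj
    rw [this]; decide

lemma odd_symm {M : CoxeterMatrix B} {s t : B} (h : Relation.ReflTransGen (OddAdj M) s t) :
    Relation.ReflTransGen (OddAdj M) t s := by
  induction h with
  | refl => exact .refl
  | tail _ h ih => exact .head (by unfold OddAdj at *; rw [M.symmetric]; exact h) ih

lemma bn_odd' {M : CoxeterMatrix B} {n : ℕ} (e : B ≃ Fin n)
    (he : ∀ a b : B, M a b = Bmat n (e a) (e b)) (hn : 3 ≤ n) (s t : B) (hs : (e s).val ≠ 0)
    (ht : (e t).val ≠ 0) : Relation.ReflTransGen (OddAdj M) s t := by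
  have h1 := bn_odd e he hn (e s).val (by omega) (e s).isLt
  have h2 := bn_odd e he hn (e t).val (by omega) (e t).isLt
  simp only [Fin.eta, Equiv.symm_apply_apply] at h1 h2
  exact (odd_symm h1).trans h2

lemma bn_X {M : CoxeterMatrix B} {n : ℕ} (e : B ≃ Fin n)
    (he : ∀ a b : B, M a b = Bmat n (e a) (e b)) (pn : 0 < n) (hn : 3 ≤ n) (X : Set B)
    (hXd : ¬ ConnectedIn M X)
    (hodd : ∀ s ∈ X, ∀ t ∈ X, ¬ ReachIn M X s t → ¬ Relation.ReflTransGen (OddAdj M) s t) :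
    ∃ Z : Set B, Z.Nonempty ∧ (∀ z ∈ Z, 2 ≤ (e z).val) ∧ ConnectedIn M Z ∧
            X = insert (e.symm ⟨0, pn⟩) Z := by
  have hreach : ∀ s ∈ X, ∀ t ∈ X, (e s).val ≠ 0 → (e t).val ≠ 0 → ReachIn M X s t := by
    intro s hs t ht h1 h2
    by_contra h
    exact hodd s hs t ht h (bn_odd' e he hn s t h1 h2)
  have h0 : ∀ s, (e s).val = 0 → s = e.symm ⟨0, pn⟩ := by
    intro s hs
    rw [Equiv.eq_symm_apply]; exact Fin.ext hs
  have hex : ∃ s ∈ X, ∃ t ∈ X, ¬ ReachIn M X s t ∧ (e s).val = 0 ∧ (e t).val ≠ 0 := by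
    unfold ConnectedIn at hXd
    push Not at hXd
    obtain ⟨s, hs, t, ht, hst⟩ := hXd
    by_cases h1 : (e s).val = 0
    · refine ⟨s, hs, t, ht, hst, h1, fun h2 => hst ?_⟩
      rw [h0 s h1, h0 t h2]
      exact .refl
    · refine ⟨t, ht, s, hs, fun h => hst h.symm', ?_, h1⟩
      by_contra h2
      exact hst (hreach s hs t ht h1 h2)
  obtain ⟨s, hs, t, ht, hst, hs0, ht0⟩ := hex
  have h1X : ∀ x ∈ X, (e x).val ≠ 1 := by
    intro x hx hx1
    have hadj : Adj M s x := by
      refine ⟨fun h => by rw [h] at hs0; omega, ?_⟩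
      rw [he, Bmat_apply, if_neg (fun h => by rw [h] at hs0; omega), if_pos (Or.inl ⟨hs0, hx1⟩)]
      norm_num
    exact hst (Relation.ReflTransGen.head ⟨hs, hx, hadj⟩ (hreach x hx t ht (by omega) ht0))
  have hiso : ∀ x ∈ X, ∀ y ∈ X, Adj M x y → (e y).val ≠ 0 := by
    intro x hx y hy hadj hy0
    have hx1 := h1X x hx
    have hxy : e x ≠ e y := fun h => hadj.1 (e.injective h)
    have hxy' : (e x).val ≠ (e y).val := fun h => hxy (Fin.ext h)
    apply hadj.2
    rw [he, Bmat_apply, if_neg hxy, if_neg (by omega), if_neg (by omega)]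
  refine ⟨{z | z ∈ X ∧ (e z).val ≠ 0}, ⟨t, ht, ht0⟩, ?_, ?_, ?_⟩
  · rintro z ⟨hz, hz0⟩
    have := h1X z hz
    omega
  · rintro a ⟨ha, ha0⟩ b ⟨hb, hb0⟩
    have h := hreach a ha b hb ha0 hb0
    clear hb hb0
    have : (e b).val ≠ 0 ∧ ReachIn M {z | z ∈ X ∧ (e z).val ≠ 0} a b := by
      induction h with
      | refl => exact ⟨ha0, .refl⟩
      | tail _ h ih =>
        have := hiso _ h.1 _ h.2.1 h.2.2
        exact ⟨this, ih.2.tail ⟨⟨h.1, ih.1⟩, ⟨h.2.1, this⟩, h.2.2⟩⟩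
    exact this.2
  · ext x
    constructor
    · intro hx
      by_cases hx0 : (e x).val = 0
      · exact Or.inl (h0 x hx0)
      · exact Or.inr ⟨hx, hx0⟩
    · rintro (rfl | hx)
      · rw [← h0 s hs0]; exact hs
      · exact hx.1

lemma classify [Finite B] (M : CoxeterMatrix B) [Finite M.Group]
    (hconn : ConnectedIn M Set.univ)
    (X : Set B) (hXproper : X ≠ Set.univ)
    (hXd : ¬ ConnectedIn M X)
    (hodd : ∀ s ∈ X, ∀ t ∈ X, ¬ ReachIn M X s t → ¬ Relation.ReflTransGen (OddAdj M) s t) :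
    (∃ n : ℕ, 3 ≤ n ∧ ∃ e : B ≃ Fin n, ∀ a b : B, M a b = Bmat n (e a) (e b)) ∨
      IsOfType M Set.univ CoxeterMatrix.F₄ := by
  obtain ⟨P⟩ := exists_PD M hconn
  have hXd' := hXd
  unfold ConnectedIn at hXd'
  push Not at hXd'
  obtain ⟨s, hs, t, ht, hst⟩ := hXd'
  have hne : s ≠ t := by rintro rfl; exact hst .refl
  obtain ⟨c, hc⟩ : ∃ c, c ∉ X := by
    by_contra! h
    exact hXproper (Set.eq_univ_of_forall h)
  have hcs : c ≠ s := by rintro rfl; exact hc hs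
  have hct : c ≠ t := by rintro rfl; exact hc ht
  have third : ∀ q p : B, ∃ w, w ≠ q ∧ w ≠ p := by
    intro q p
    by_contra! h
    by_cases h1 : s = q
    · by_cases h2 : t = q
      · exact hne (h1.trans h2.symm)
      · have := h t h2
        by_cases h3 : c = q
        · exact hcs (h3.trans h1.symm)
        · exact hct ((h c h3).trans this.symm)
    · have hsp := h s h1
      by_cases h2 : t = q
      · by_cases h3 : c = q
        · exact hct (h3.trans h2.symm)
        · exact hcs ((h c h3).trans hsp.symm)
      · exact hne (hsp.trans (h t h2).symm)
  have hedge : ∃ q p, Adj M q p ∧ ¬ Odd (M q p) := by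
    by_contra! h
    apply hodd s hs t ht hst
    have hr := hconn s trivial t trivial
    unfold ReachIn at hr
    exact hr.lift id (fun a b hab => h a b hab.2.2)
  obtain ⟨q, p, hqp, hev⟩ := hedge
  rw [Nat.not_odd_iff_even] at hev
  have h4 : M q p = 4 := by
    by_contra h4
    have h2 := hqp.2
    have h1 := M_ne_one M hqp.1
    have h6 : M q p = 0 ∨ 6 ≤ M q p := by
      obtain ⟨m, hm⟩ := hev
      omega
    obtain ⟨w, hw⟩ := third q p
    obtain ⟨x, hx, y, hy, hxy⟩ := closed_univ_not hconn {q, p} (a := q) (w := w) (by simp)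
      (by simpa using hw)
    simp only [Set.mem_insert_iff, Set.mem_singleton_iff, not_or] at hx hy
    rcases hx with rfl | rfl
    · exact P.no_six hqp.1.symm (by rw [M.symmetric]; exact h6) hxy (Ne.symm hy.2)
    · exact P.no_six hqp.1 h6 hxy (Ne.symm hy.1)
  by_cases hq : ∀ u, Adj M q u → u = p
  · exact Or.inl (bn_type P hconn hqp.1 h4 hq (third q p))
  by_cases hp : ∀ u, Adj M p u → u = q
  · exact Or.inl (bn_type P hconn hqp.1.symm (by rw [M.symmetric]; exact h4) hp (third p q))
  push Not at hq hp
  obtain ⟨r, hr, hrp⟩ := hq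
  obtain ⟨u, hu, huq⟩ := hp
  exact Or.inr (f4_type P hconn hqp.1 h4 hr hrp hu huq)

end
end ArtinTits

namespace ArtinTits

open CoxeterMatrix in
/-- Theorem 1(2) of the paper: classification of conjugacy stable reducible standard
parabolic subgroups of irreducible Artin–Tits groups of spherical type. -/
theorem conjugacy_stability_reducible_parabolic
    {B : Type*} [Finite B] (M : CoxeterMatrix B) [Finite M.Group]
    (hconn : ConnectedIn M Set.univ)
    (X : Set B) (hX : X.Nonempty) (hXproper : X ≠ Set.univ)
    (hXdisconn : ¬ ConnectedIn M X) :
    IsConjugacyStable (AP M X) ↔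
      ((∃ n : ℕ, ∃ hn : 3 ≤ n, ∃ e : B ≃ Fin n,
          (∀ a b : B, M a b = Bmat n (e a) (e b)) ∧
          ∃ Z : Set B, Z.Nonempty ∧ (∀ z ∈ Z, 2 ≤ (e z).val) ∧ ConnectedIn M Z ∧
            X = insert (e.symm ⟨0, by omega⟩) Z) ∨
        IsOfType M Set.univ F₄) := by
  constructor
  · intro hstab
    have hodd : ∀ s ∈ X, ∀ t ∈ X, ¬ ReachIn M X s t →
        ¬ Relation.ReflTransGen (OddAdj M) s t :=
      fun s hs t ht hr h => not_stable M X hs ht hr h hstab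
    rcases classify M hconn X hXproper hXdisconn hodd with ⟨n, hn, e, he⟩ | h
    · exact Or.inl ⟨n, hn, e, he, bn_X e he (by omega) hn X hXdisconn hodd⟩
    · exact Or.inr h
  · rintro (⟨n, hn, e, he, Z, hZne, hZ, hZc, rfl⟩ | ⟨e, he⟩)
    · exact bn_stable M n e he (by omega) hn Z hZne hZ hZc
    · exact f4_stable M ((Equiv.Set.univ B).symm.trans e) (fun a b => he ⟨a, trivial⟩ ⟨b, trivial⟩)
        X hXdisconn

end ArtinTits
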